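/- Let d ≥ 1, k > 0, p ∈ [2, ∞), and let E : ℝ^d → ℝ^d satisfy (H0), (H1) and (H2) for this p (i.e. −(p/p') div E(x) + k x·E(x)/(1+|x|²) ≥ β₀ for all x, where 1/p + 1/p' = 1). Then there exists λ₁ ∈ ℝ such that for every λ ≥ λ₁ and every f₀ ∈ L²_k ∩ L^p_k with f₀ ≥ 0 a.e., the weak solution φ ∈ H¹_k of λ φ − div(∇φ + E φ) = f₀ satisfies φ ∈ L^p_k and ‖φ‖_{L^p_k} ≤ ‖f₀‖_{L^p_k}, and moreover ∫_{ℝ^d} |∇φ(x)|² φ(x)^{p−2} ⟨x⟩^k dx < ∞. -/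

import Mathlib

open MeasureTheory Real Filter Topology RealInnerProductSpace
open scoped BigOperators

noncomputable section

/-- The weight `⟨x⟩ᵏ = (1+|x|²)^{k/2}`. -/
def jap {d : ℕ} (k : ℝ) (x : EuclideanSpace ℝ (Fin d)) : ℝ :=
  (1 + ‖x‖ ^ 2) ^ (k / 2)

/-- The divergence of a vector field on `ℝᵈ`. -/
def dvg {d : ℕ} (E : EuclideanSpace ℝ (Fin d) → EuclideanSpace ℝ (Fin d))
    (x : EuclideanSpace ℝ (Fin d)) : ℝ :=
  ∑ i, ⟪fderiv ℝ E x (EuclideanSpace.single i 1), EuclideanSpace.single i 1⟫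

/-- The Laplacian of a scalar function on `ℝᵈ`. -/
def lap {d : ℕ} (f : EuclideanSpace ℝ (Fin d) → ℝ) (x : EuclideanSpace ℝ (Fin d)) : ℝ :=
  dvg (gradient f) x

/-- The Fokker–Planck operator `Lf = div(∇f + E f)`. -/
def Lop {d : ℕ} (E : EuclideanSpace ℝ (Fin d) → EuclideanSpace ℝ (Fin d))
    (f : EuclideanSpace ℝ (Fin d) → ℝ) (x : EuclideanSpace ℝ (Fin d)) : ℝ :=
  dvg (fun y => gradient f y + f y • E y) x

/-- Hypothesis (H0): `E ∈ W^{1,∞}_loc(ℝᵈ; ℝᵈ)` (classical formulation: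
`E` is differentiable with locally bounded values and derivative). -/
def H0 {d : ℕ} (E : EuclideanSpace ℝ (Fin d) → EuclideanSpace ℝ (Fin d)) : Prop :=
  Differentiable ℝ E ∧ ∀ R : ℝ, ∃ C : ℝ, ∀ x, ‖x‖ ≤ R → ‖E x‖ + ‖fderiv ℝ E x‖ ≤ C

/-- Hypothesis (H1): `α|x|^γ − β ≤ x·E(x) ≤ α₂|x|^{γ₂} + β₂` with
`α, α₂ > 0` and `1 < γ ≤ γ₂ ≤ 2`. -/
def H1 {d : ℕ} (E : EuclideanSpace ℝ (Fin d) → EuclideanSpace ℝ (Fin d)) : Prop :=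
  ∃ α α₂ β β₂ γ γ₂ : ℝ, 0 < α ∧ 0 < α₂ ∧ 1 < γ ∧ γ ≤ γ₂ ∧ γ₂ ≤ 2 ∧
    ∀ x : EuclideanSpace ℝ (Fin d),
      α * ‖x‖ ^ γ - β ≤ ⟪x, E x⟫ ∧ ⟪x, E x⟫ ≤ α₂ * ‖x‖ ^ γ₂ + β₂

/-- Hypothesis (H2) with `p = 2` (so `p/p' = 1`) and constant `β₀`:
`−div E(x) + k x·E(x)/(1+|x|²) ≥ β₀` for all `x`. -/
def H2 {d : ℕ} (k β₀ : ℝ) (E : EuclideanSpace ℝ (Fin d) → EuclideanSpace ℝ (Fin d)) : Prop :=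
  ∀ x : EuclideanSpace ℝ (Fin d), β₀ ≤ -dvg E x + k * ⟪x, E x⟫ / (1 + ‖x‖ ^ 2)

/-- Hypothesis (H3) with `p = 2` and constant `ω* > 0`:
`−(kd + k(k+d−2)|x|²)/(1+|x|²)² − div E(x) + k x·E(x)/(1+|x|²) ≥ ω*` for all `x`. -/
def H3 {d : ℕ} (k ωs : ℝ) (E : EuclideanSpace ℝ (Fin d) → EuclideanSpace ℝ (Fin d)) : Prop :=
  ∀ x : EuclideanSpace ℝ (Fin d),
    ωs ≤ -(k * (d : ℝ) + k * (k + (d : ℝ) - 2) * ‖x‖ ^ 2) / (1 + ‖x‖ ^ 2) ^ 2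
          - dvg E x + k * ⟪x, E x⟫ / (1 + ‖x‖ ^ 2)

/-- Pairing an `L²` function with the translates of another one is continuous in the shift. -/
lemma continuous_integral_inner_translate {d : ℕ} {V : Type*} [NormedAddCommGroup V]
    [InnerProductSpace ℝ V] {F h : EuclideanSpace ℝ (Fin d) → V}
    (hF : MemLp F 2 volume) (hh : MemLp h 2 volume) :
    Continuous fun t => ∫ x, ⟪F x, h (t + x)⟫ := by
  have h1 : Continuous fun t : EuclideanSpace ℝ (Fin d) =>
      (inner ℝ (hF.toLp F) (DomAddAct.mk t +ᵥ hh.toLp h) : ℝ) := by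
    refine continuous_const.inner ?_
    have : Continuous fun t : EuclideanSpace ℝ (Fin d) =>
      (DomAddAct.mk t, hh.toLp h) := by
      exact (DomAddAct.continuous_mk).prodMk continuous_const
    have h2 : Fact ((2 : ENNReal) ≠ ⊤) := ⟨by norm_num⟩
    exact continuous_vadd.comp this
  convert h1 using 2 with t
  rw [L2.inner_def]
  refine integral_congr_ae ?_
  filter_upwards [hF.coeFn_toLp, DomAddAct.vadd_Lp_ae_eq (DomAddAct.mk t) (hh.toLp h),
    ((measurePreserving_add_left volume t).quasiMeasurePreserving.ae hh.coeFn_toLp)]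
    with x hx1 hx2 hx3
  rw [hx1, hx2]
  simp only [Equiv.symm_apply_apply, vadd_eq_add] at *
  rw [hx3]

/-- Mollifications of an `L²` function converge weakly in `L²`. -/
lemma tendsto_integral_inner_mollify {d : ℕ} {V : Type*} [NormedAddCommGroup V]
    [InnerProductSpace ℝ V] [CompleteSpace V] {F h : EuclideanSpace ℝ (Fin d) → V}
    (hF : MemLp F 2 volume) (hh : MemLp h 2 volume)
    {ρ : ℕ → ContDiffBump (0 : EuclideanSpace ℝ (Fin d))}
    (hρ : Tendsto (fun n => (ρ n).rOut) atTop (𝓝 0)) :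
    Tendsto (fun n => ∫ x, ⟪F x, ∫ t, (ρ n).normed volume t • h (x - t)⟫) atTop
      (𝓝 (∫ x, ⟪F x, h x⟫)) := by
  have hc := continuous_integral_inner_translate hF hh
  have key := ContDiffBump.convolution_tendsto_right_of_continuous (μ := volume) hρ hc 0
  simp only [zero_add] at key
  refine key.congr fun n => ?_
  rw [convolution_def]
  simp only [ContinuousLinearMap.lsmul_apply, zero_sub]
  set r := (ρ n).normed volume with hr
  have hrc : Continuous r := (ρ n).continuous_normed
  have hrs : HasCompactSupport r := (ρ n).hasCompactSupport_normed
  have hri : Integrable r := (ρ n).integrable_normed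
  have hloc : LocallyIntegrable h volume := hh.locallyIntegrable (by norm_num)
  have hex : ∀ x, Integrable (fun t => r t • h (x - t)) := fun x =>
    hrs.convolutionExists_left (ContinuousLinearMap.lsmul ℝ ℝ) hrc hloc x
  have h1 : ∀ x, ⟪F x, ∫ t, r t • h (x - t)⟫ = ∫ t, r t * ⟪F x, h (x - t)⟫ := by
    intro x
    rw [← integral_inner (hex x)]
    simp only [inner_smul_right]
  simp only [h1]
  rw [integral_integral_swap]
  · refine integral_congr_ae (Eventually.of_forall fun t => ?_)
    simp only [smul_eq_mul]
    rw [← integral_const_mul]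
    simp only [neg_add_eq_sub]
  · have hF2 : Integrable (fun x => ‖F x‖ ^ 2) := hF.integrable_norm_pow (by norm_num)
    have hh2 : Integrable (fun x => ‖h x‖ ^ 2) := hh.integrable_norm_pow (by norm_num)
    have i1 : Integrable (fun z : EuclideanSpace ℝ (Fin d) × EuclideanSpace ℝ (Fin d) =>
        ‖F z.1‖ ^ 2 * r z.2) (volume.prod volume) := hF2.mul_prod hri
    have i2 : Integrable (fun z : EuclideanSpace ℝ (Fin d) × EuclideanSpace ℝ (Fin d) =>
        r z.2 * ‖h (z.1 - z.2)‖ ^ 2) (volume.prod volume) :=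
      hri.convolution_integrand (ContinuousLinearMap.lsmul ℝ ℝ) hh2
    refine (i1.add i2).mono' ?_ (Eventually.of_forall fun z => ?_)
    · have m1 : AEStronglyMeasurable (fun z : EuclideanSpace ℝ (Fin d) × EuclideanSpace ℝ (Fin d) =>
          r z.2 • h (z.1 - z.2)) (volume.prod volume) :=
        hri.aestronglyMeasurable.convolution_integrand (ContinuousLinearMap.lsmul ℝ ℝ)
          hh.aestronglyMeasurable
      have := (hF.aestronglyMeasurable.comp_fst (ν := (volume :
        Measure (EuclideanSpace ℝ (Fin d))))).inner m1 (𝕜 := ℝ)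
      simp only [inner_smul_right] at this
      exact this
    · have hr0 : 0 ≤ r z.2 := (ρ n).nonneg_normed _
      have := abs_real_inner_le_norm (F z.1) (h (z.1 - z.2))
      simp only [Function.uncurry, norm_mul, Real.norm_eq_abs, abs_of_nonneg hr0, Pi.add_apply]
      nlinarith [mul_nonneg hr0 (sq_nonneg (‖F z.1‖ - ‖h (z.1 - z.2)‖)),
        mul_le_mul_of_nonneg_left this hr0, mul_nonneg hr0 (sq_nonneg ‖F z.1‖),
        mul_nonneg hr0 (sq_nonneg ‖h (z.1 - z.2)‖)]

/-- The gradient of a mollification is the mollification of the gradient. -/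
lemma gradient_mollify {d : ℕ} {g r : EuclideanSpace ℝ (Fin d) → ℝ}
    (hr : ContDiff ℝ 1 r) (hrs : HasCompactSupport r) (hg : Differentiable ℝ g)
    (hg' : LocallyIntegrable (gradient g) volume) (x : EuclideanSpace ℝ (Fin d)) :
    gradient (fun y => ∫ t, r t • g (y - t)) x = ∫ t, r t • gradient g (x - t) := by
  have hloc : LocallyIntegrable g volume := hg.continuous.locallyIntegrable
  have hex : Integrable (fun t => r t • gradient g (x - t)) :=
    hrs.convolutionExists_left (ContinuousLinearMap.lsmul ℝ ℝ) hr.continuous hg' x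
  have hD := hrs.hasFDerivAt_convolution_left (ContinuousLinearMap.lsmul ℝ ℝ) hr hloc x
  have hrd : Differentiable ℝ r := hr.differentiable (by norm_num)
  have hr'c : Continuous (fderiv ℝ r) := hr.continuous_fderiv (by norm_num)
  refine ext_inner_right ℝ fun v => ?_
  rw [← real_inner_comm (∫ t, r t • gradient g (x - t)) v, ← integral_inner hex, gradient]
  rw [InnerProductSpace.toDual_symm_apply]
  have e1 : fderiv ℝ (fun y => ∫ t, r t • g (y - t)) x
      = (convolution (fderiv ℝ r) g ((ContinuousLinearMap.lsmul ℝ ℝ).precompL _) volume) x :=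
    hD.fderiv
  have hex2 : Integrable (fun t =>
      ((ContinuousLinearMap.lsmul ℝ ℝ).precompL (EuclideanSpace ℝ (Fin d)) (fderiv ℝ r t))
        (g (x - t))) :=
    (hrs.fderiv ℝ).convolutionExists_left _ hr'c hloc x
  rw [e1, convolution_def, ContinuousLinearMap.integral_apply hex2]
  simp only [ContinuousLinearMap.precompL_apply, ContinuousLinearMap.lsmul_apply, inner_smul_right]
  have hgx : ∀ t, HasFDerivAt (fun t => g (x - t)) (-(fderiv ℝ g (x - t))) t := by
    intro t
    have := (hg (x - t)).hasFDerivAt.comp t ((hasFDerivAt_id t).const_sub x)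
    rw [ContinuousLinearMap.comp_neg, ContinuousLinearMap.comp_id] at this
    exact this
  have hin : ∀ t, ⟪v, gradient g (x - t)⟫ = fderiv ℝ g (x - t) v := by
    intro t
    rw [real_inner_comm, gradient, InnerProductSpace.toDual_symm_apply]
  have hcs : HasCompactSupport (fun t => r t * g (x - t)) := hrs.mul_right
  have i1 : Integrable (fun t => fderiv ℝ r t v * g (x - t)) := by
    refine Continuous.integrable_of_hasCompactSupport ?_ ?_
    · exact (hr'c.clm_apply continuous_const).mul
        (hg.continuous.comp (continuous_const.sub continuous_id))
    · refine HasCompactSupport.mul_right ?_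
      exact (hrs.fderiv ℝ).comp_left (g := fun L : EuclideanSpace ℝ (Fin d) →L[ℝ] ℝ => L v)
        (by simp)
  have i2 : Integrable (fun t => r t * (-(fderiv ℝ g (x - t))) v) := by
    have := (hex.const_inner v (𝕜 := ℝ)).neg
    refine this.congr (Eventually.of_forall fun t => ?_)
    simp [inner_smul_right, hin]
  have i3 : Integrable (fun t => r t * g (x - t)) :=
    (hr.continuous.mul (hg.continuous.comp
      (continuous_const.sub continuous_id))).integrable_of_hasCompactSupport hcs
  have key := integral_bilinear_hasFDerivAt_right_eq_neg_left_of_integrable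
    (B := ContinuousLinearMap.mul ℝ ℝ) (v := v) (μ := volume)
    (f := r) (g := fun t => g (x - t)) (f' := fderiv ℝ r) i1 i2 i3
    (fun t _ => (hrd t).hasFDerivAt) (fun t _ => hgx t)
  simp only [ContinuousLinearMap.mul_apply', neg_apply, mul_neg, integral_neg, neg_inj] at key
  simp only [hin, smul_eq_mul]
  exact key.symm

/-- A distributional identity with locally square integrable coefficients extends to compactly
supported differentiable test functions with square integrable gradient. -/
lemma weak_form_extend {d : ℕ} {A : EuclideanSpace ℝ (Fin d) → ℝ}
    {F : EuclideanSpace ℝ (Fin d) → EuclideanSpace ℝ (Fin d)}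
    (hA : MemLp A 2 volume)
    (hF : ∀ R : ℝ, MemLp ((Metric.closedBall 0 R).indicator F) 2 volume)
    (hw : ∀ ψ : EuclideanSpace ℝ (Fin d) → ℝ, ContDiff ℝ (⊤ : ℕ∞) ψ → HasCompactSupport ψ →
      (∫ x, ⟪A x, ψ x⟫) + ∫ x, ⟪F x, gradient ψ x⟫ = 0)
    {g : EuclideanSpace ℝ (Fin d) → ℝ} (hg : Differentiable ℝ g) (hgs : HasCompactSupport g)
    (hg' : MemLp (gradient g) 2 volume) :
    (∫ x, ⟪A x, g x⟫) + ∫ x, ⟪F x, gradient g x⟫ = 0 := by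
  obtain ⟨R, hR⟩ := hgs.isCompact.isBounded.subset_closedBall (0 : EuclideanSpace ℝ (Fin d))
  have grad_zero : ∀ (u : EuclideanSpace ℝ (Fin d) → ℝ) x, x ∉ tsupport u → gradient u x = 0 := by
    intro u x hx
    rw [gradient, fderiv_of_notMem_tsupport ℝ hx, map_zero]
  have hFi : ∀ u : EuclideanSpace ℝ (Fin d) → ℝ, tsupport u ⊆ Metric.closedBall 0 (R + 1) →
      ∫ x, ⟪F x, gradient u x⟫
        = ∫ x, ⟪(Metric.closedBall 0 (R + 1)).indicator F x, gradient u x⟫ := by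
    intro u hu
    congr 1
    ext x
    by_cases hx : x ∈ Metric.closedBall (0 : EuclideanSpace ℝ (Fin d)) (R + 1)
    · rw [Set.indicator_of_mem hx]
    · rw [grad_zero u x (fun h => hx (hu h)), inner_zero_right, inner_zero_right]
  let ρ : ℕ → ContDiffBump (0 : EuclideanSpace ℝ (Fin d)) := fun n =>
    ⟨1 / (n + 2) / 2, 1 / (n + 2), by positivity, by
      have : (0 : ℝ) < 1 / (n + 2) := by positivity
      linarith⟩
  have hρ : Tendsto (fun n => (ρ n).rOut) atTop (𝓝 0) := by
    have := (tendsto_const_div_atTop_nhds_zero_nat (1 : ℝ)).comp (tendsto_add_atTop_nat 2)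
    refine this.congr fun n => ?_
    simp [ρ]
  have hgL : MemLp g 2 volume := hg.continuous.memLp_of_hasCompactSupport hgs
  have t1 := tendsto_integral_inner_mollify hA hgL hρ
  have t2 := tendsto_integral_inner_mollify (hF (R + 1)) hg' hρ
  rw [hFi g (hR.trans (Metric.closedBall_subset_closedBall (by linarith)))]
  refine tendsto_nhds_unique (t1.add t2) ?_
  refine tendsto_const_nhds.congr fun n => ?_
  have hrc : ContDiff ℝ (⊤ : ℕ∞) ((ρ n).normed volume) := (ρ n).contDiff_normed
  have hrs : HasCompactSupport ((ρ n).normed volume) := (ρ n).hasCompactSupport_normed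
  let ψ : EuclideanSpace ℝ (Fin d) → ℝ := fun x => ∫ t, (ρ n).normed volume t • g (x - t)
  have hψ1 : ContDiff ℝ (⊤ : ℕ∞) ψ :=
    hrs.contDiff_convolution_left (ContinuousLinearMap.lsmul ℝ ℝ) hrc
      hg.continuous.locallyIntegrable
  have hψ2 : HasCompactSupport ψ :=
    hrs.convolution (ContinuousLinearMap.lsmul ℝ ℝ) hgs
  have hψ3 : tsupport ψ ⊆ Metric.closedBall 0 (R + 1) := by
    refine closure_minimal ?_ Metric.isClosed_closedBall
    refine (support_convolution_subset (μ := volume) (ContinuousLinearMap.lsmul ℝ ℝ)).trans ?_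
    rintro _ ⟨a, ha, b, hb, rfl⟩
    rw [(ρ n).support_normed_eq] at ha
    have hb' := hR (subset_tsupport g hb)
    simp only [Metric.mem_ball, dist_zero_right, Metric.mem_closedBall] at ha hb' ⊢
    have : (ρ n).rOut ≤ 1 := by
      simp only [ρ]
      rw [div_le_one (by positivity)]
      linarith [(Nat.cast_nonneg n : (0 : ℝ) ≤ n)]
    linarith [norm_add_le a b]
  have e := hw ψ hψ1 hψ2
  rw [hFi ψ hψ3] at e
  rw [← e]
  congr 2
  ext x
  rw [gradient_mollify (hrc.of_le (by exact_mod_cast le_top)) hrs hg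
    (hg'.locallyIntegrable (by norm_num)) x]

/-- The bounded approximation `(s² / (1 + ε s²))ᵐ` of `|s|^{2m}`. -/
def truncPow (m ε s : ℝ) : ℝ := (s ^ 2 * (1 + ε * s ^ 2)⁻¹) ^ m

/-- A Lipschitz approximation of `s |s|^{2m}`. -/
def truncTest (m ε s : ℝ) : ℝ :=
  s * (truncPow m ε s * (1 + m * (1 + ε * s ^ 2)⁻¹) / (1 + m))

/-- The derivative of `truncTest`. -/
def truncTestDeriv (m ε s : ℝ) : ℝ :=
  truncPow m ε s * (1 + m * (1 + ε * s ^ 2)⁻¹ + 2 * m * (1 + m) * ((1 + ε * s ^ 2)⁻¹) ^ 2) / (1 + m)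

/-- The primitive of `s * truncTestDeriv m ε s` vanishing at the origin. -/
def truncPrim (m ε s : ℝ) : ℝ :=
  s * (s * (truncPow m ε s * (1 + 2 * m * (1 + ε * s ^ 2)⁻¹)) / (2 * (1 + m)))

section Truncation

variable {m ε : ℝ}

lemma one_add_mul_sq_pos (hε : 0 < ε) (s : ℝ) : 0 < 1 + ε * s ^ 2 := by positivity

lemma continuous_inv_one_add (hε : 0 < ε) : Continuous fun s : ℝ => (1 + ε * s ^ 2)⁻¹ :=
  Continuous.inv₀ (by fun_prop) fun s => (one_add_mul_sq_pos hε s).ne'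

lemma continuous_truncPow (hm : 0 ≤ m) (hε : 0 < ε) : Continuous (truncPow m ε) := by
  unfold truncPow
  exact ((continuous_pow 2).mul (continuous_inv_one_add hε)).rpow_const fun _ => Or.inr hm

lemma truncPow_nonneg (hε : 0 < ε) (s : ℝ) : 0 ≤ truncPow m ε s := by
  have := one_add_mul_sq_pos hε s
  unfold truncPow
  positivity

lemma continuous_truncTestDeriv (hm : 0 ≤ m) (hε : 0 < ε) : Continuous (truncTestDeriv m ε) := by
  have h1 := continuous_truncPow hm hε
  have h2 := continuous_inv_one_add hε
  unfold truncTestDeriv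
  fun_prop

lemma hasDerivAt_truncPow (hε : 0 < ε) {s : ℝ} (hs : s ≠ 0) :
    HasDerivAt (truncPow m ε) (2 * m * (1 + ε * s ^ 2)⁻¹ * truncPow m ε s / s) s := by
  have hp := one_add_mul_sq_pos hε s
  have h1 : HasDerivAt (fun s : ℝ => s ^ 2 * (1 + ε * s ^ 2)⁻¹)
      (2 * s * (1 + ε * s ^ 2)⁻¹ + s ^ 2 * (-(ε * (2 * s)) / (1 + ε * s ^ 2) ^ 2)) s := by
    have := (((hasDerivAt_pow 2 s).const_mul ε).const_add 1).inv hp.ne'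
    refine ((hasDerivAt_pow 2 s).mul this).congr_deriv ?_
    simp
  have hu : 0 < s ^ 2 * (1 + ε * s ^ 2)⁻¹ := by positivity
  have h2 := h1.rpow_const (p := m) (Or.inl hu.ne')
  unfold truncPow
  convert h2 using 1
  rw [rpow_sub_one hu.ne']
  field_simp
  ring

lemma hasDerivAt_mul_self_zero {h : ℝ → ℝ} (hc : Continuous h) :
    HasDerivAt (fun s => s * h s) (h 0) 0 := by
  rw [hasDerivAt_iff_tendsto_slope_zero]
  have : Tendsto h (𝓝[≠] 0) (𝓝 (h 0)) := (hc.tendsto 0).mono_left nhdsWithin_le_nhds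
  refine this.congr' ?_
  filter_upwards [self_mem_nhdsWithin] with t ht
  have ht' : t ≠ 0 := ht
  simp [ht']

lemma hasDerivAt_inv_one_add (hε : 0 < ε) (s : ℝ) :
    HasDerivAt (fun s : ℝ => (1 + ε * s ^ 2)⁻¹) (-(2 * ε * s) * ((1 + ε * s ^ 2)⁻¹) ^ 2) s := by
  have hp := one_add_mul_sq_pos hε s
  have := (((hasDerivAt_pow 2 s).const_mul ε).const_add 1).inv hp.ne'
  refine this.congr_deriv ?_
  field_simp
  ring

lemma hasDerivAt_truncTest (hm : 0 ≤ m) (hε : 0 < ε) (s : ℝ) :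
    HasDerivAt (truncTest m ε) (truncTestDeriv m ε s) s := by
  have hm1 : (1 + m) ≠ 0 := by positivity
  rcases eq_or_ne s 0 with rfl | hs
  · have h1 := continuous_truncPow hm hε
    have h2 := continuous_inv_one_add hε
    have := hasDerivAt_mul_self_zero
      (h := fun s => truncPow m ε s * (1 + m * (1 + ε * s ^ 2)⁻¹) / (1 + m)) (by fun_prop)
    unfold truncTest
    convert this using 1
    rcases eq_or_ne m 0 with rfl | hm0
    · simp [truncTestDeriv]
    · simp [truncTestDeriv, truncPow, zero_rpow hm0]
  · have hp := one_add_mul_sq_pos hε s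
    have h1 := hasDerivAt_truncPow (m := m) hε hs
    have h2 := hasDerivAt_inv_one_add hε s
    have := (hasDerivAt_id s).mul ((h1.mul ((h2.const_mul m).const_add 1)).div_const (1 + m))
    unfold truncTest
    refine this.congr_deriv ?_
    simp only [truncTestDeriv, id, Pi.mul_apply]
    field_simp
    ring

lemma hasDerivAt_truncPrim (hm : 0 ≤ m) (hε : 0 < ε) (s : ℝ) :
    HasDerivAt (truncPrim m ε) (s * truncTestDeriv m ε s) s := by
  have hm1 : (1 + m) ≠ 0 := by positivity
  rcases eq_or_ne s 0 with rfl | hs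
  · have h1 := continuous_truncPow hm hε
    have h2 := continuous_inv_one_add hε
    have := hasDerivAt_mul_self_zero
      (h := fun s => s * (truncPow m ε s * (1 + 2 * m * (1 + ε * s ^ 2)⁻¹)) / (2 * (1 + m)))
      (by fun_prop)
    unfold truncPrim
    convert this using 1
    simp
  · have hp := one_add_mul_sq_pos hε s
    have h1 := hasDerivAt_truncPow (m := m) hε hs
    have h2 := hasDerivAt_inv_one_add hε s
    have := (hasDerivAt_id s).mul (((hasDerivAt_id s).mul
      (h1.mul ((h2.const_mul (2 * m)).const_add 1))).div_const (2 * (1 + m)))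
    unfold truncPrim
    refine this.congr_deriv ?_
    simp only [truncTestDeriv, id, Pi.mul_apply]
    field_simp
    ring

lemma inv_one_add_mem (hε : 0 < ε) (s : ℝ) :
    0 < (1 + ε * s ^ 2)⁻¹ ∧ (1 + ε * s ^ 2)⁻¹ ≤ 1 := by
  have hp := one_add_mul_sq_pos hε s
  refine ⟨by positivity, inv_le_one_of_one_le₀ ?_⟩
  have : 0 ≤ ε * s ^ 2 := by positivity
  linarith

lemma truncPrim_nonneg (hm : 0 ≤ m) (hε : 0 < ε) (s : ℝ) : 0 ≤ truncPrim m ε s := by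
  obtain ⟨h1, -⟩ := inv_one_add_mem hε s
  have h2 := truncPow_nonneg (m := m) hε s
  have : truncPrim m ε s =
      s ^ 2 * (truncPow m ε s * (1 + 2 * m * (1 + ε * s ^ 2)⁻¹)) / (2 * (1 + m)) := by
    unfold truncPrim; ring
  rw [this]
  positivity

lemma truncPrim_le (hm : 0 ≤ m) (hε : 0 < ε) (s : ℝ) :
    truncPrim m ε s ≤ s * truncTest m ε s := by
  obtain ⟨h1, -⟩ := inv_one_add_mem hε s
  have h2 := truncPow_nonneg (m := m) hε s
  have hm1 : (1 + m) ≠ 0 := by positivity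
  have : s * truncTest m ε s - truncPrim m ε s = s ^ 2 * truncPow m ε s / (2 * (1 + m)) := by
    unfold truncPrim truncTest
    field_simp
    ring
  have : 0 ≤ s * truncTest m ε s - truncPrim m ε s := by
    rw [this]; positivity
  linarith

lemma truncTestDeriv_ge (hm : 0 ≤ m) (hε : 0 < ε) (s : ℝ) :
    truncPow m ε s * (1 + m * (1 + ε * s ^ 2)⁻¹) / (1 + m) ≤ truncTestDeriv m ε s := by
  obtain ⟨h1, -⟩ := inv_one_add_mem hε s
  have h2 := truncPow_nonneg (m := m) hε s
  have : 0 ≤ 2 * m * (1 + m) * ((1 + ε * s ^ 2)⁻¹) ^ 2 := by positivity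
  unfold truncTestDeriv
  refine div_le_div_of_nonneg_right (mul_le_mul_of_nonneg_left ?_ h2) (by positivity)
  linarith

lemma truncPow_le_truncTestDeriv (hm : 0 ≤ m) (hε : 0 < ε) (s : ℝ) :
    truncPow m ε s / (1 + m) ≤ truncTestDeriv m ε s := by
  refine le_trans ?_ (truncTestDeriv_ge hm hε s)
  obtain ⟨h1, -⟩ := inv_one_add_mem hε s
  have h2 := truncPow_nonneg (m := m) hε s
  gcongr
  have : 0 ≤ m * (1 + ε * s ^ 2)⁻¹ := by positivity
  nlinarith

lemma sq_truncTest_le (hm : 0 ≤ m) (hε : 0 < ε) (s : ℝ) :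
    truncTest m ε s ^ 2 ≤ truncTestDeriv m ε s * (s * truncTest m ε s) := by
  have h := truncTestDeriv_ge hm hε s
  obtain ⟨h1, -⟩ := inv_one_add_mem hε s
  have h2 := truncPow_nonneg (m := m) hε s
  have e : truncTest m ε s = s * (truncPow m ε s * (1 + m * (1 + ε * s ^ 2)⁻¹) / (1 + m)) := rfl
  set c := truncPow m ε s * (1 + m * (1 + ε * s ^ 2)⁻¹) / (1 + m) with hc
  have hc0 : 0 ≤ c := by positivity
  rw [e]
  nlinarith [mul_le_mul_of_nonneg_right h (mul_nonneg (sq_nonneg s) hc0)]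

lemma truncTestDeriv_le (hm : 0 ≤ m) (hε : 0 < ε) (s : ℝ) :
    truncTestDeriv m ε s ≤ (1 + 2 * m) * truncPow m ε s := by
  obtain ⟨h1, h1'⟩ := inv_one_add_mem hε s
  have h2 := truncPow_nonneg (m := m) hε s
  have hm1 : 0 < 1 + m := by positivity
  unfold truncTestDeriv
  rw [div_le_iff₀ hm1]
  set q := (1 + ε * s ^ 2)⁻¹
  have hq2 : q ^ 2 ≤ 1 := pow_le_one₀ h1.le h1'
  have : 1 + m * q + 2 * m * (1 + m) * q ^ 2 ≤ (1 + 2 * m) * (1 + m) := by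
    nlinarith [mul_le_mul_of_nonneg_left h1' hm,
      mul_le_mul_of_nonneg_left hq2 (show 0 ≤ 2 * m * (1 + m) by positivity)]
  calc _ ≤ truncPow m ε s * ((1 + 2 * m) * (1 + m)) := by gcongr
    _ = _ := by ring

lemma truncPow_le (hm : 0 ≤ m) (hε : 0 < ε) (s : ℝ) : truncPow m ε s ≤ (ε⁻¹) ^ m := by
  have hp := one_add_mul_sq_pos hε s
  unfold truncPow
  refine rpow_le_rpow (by positivity) ?_ hm
  rw [← div_eq_mul_inv, div_le_iff₀ hp]
  have : ε⁻¹ * (1 + ε * s ^ 2) = ε⁻¹ + s ^ 2 := by field_simp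
  rw [this]
  have : 0 < ε⁻¹ := by positivity
  linarith

lemma truncPow_le_abs_rpow (hm : 0 ≤ m) (hε : 0 < ε) (s : ℝ) :
    truncPow m ε s ≤ |s| ^ (2 * m) := by
  obtain ⟨h1, h1'⟩ := inv_one_add_mem hε s
  have : |s| ^ (2 * m) = (s ^ 2) ^ m := by
    rw [rpow_mul (abs_nonneg s)]; simp
  rw [this]
  unfold truncPow
  refine rpow_le_rpow (by positivity) ?_ hm
  nlinarith [sq_nonneg s]

lemma abs_truncTest_le_mul (hm : 0 ≤ m) (hε : 0 < ε) (s : ℝ) :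
    |truncTest m ε s| ≤ |s| * truncPow m ε s := by
  obtain ⟨h1, h1'⟩ := inv_one_add_mem hε s
  have h2 := truncPow_nonneg (m := m) hε s
  have hm1 : 0 < 1 + m := by positivity
  unfold truncTest
  rw [abs_mul]
  gcongr
  rw [abs_of_nonneg (by positivity), div_le_iff₀ hm1]
  gcongr
  nlinarith

lemma tendsto_truncPow (hm : 0 ≤ m) {e : ℕ → ℝ} (he : Tendsto e atTop (𝓝 0)) (s : ℝ) :
    Tendsto (fun n => truncPow m (e n) s) atTop (𝓝 (|s| ^ (2 * m))) := by
  have h1 : Tendsto (fun n => s ^ 2 * (1 + e n * s ^ 2)⁻¹) atTop (𝓝 (s ^ 2)) := by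
    have : Tendsto (fun n => s ^ 2 * (1 + e n * s ^ 2)⁻¹) atTop (𝓝 (s ^ 2 * (1 + 0 * s ^ 2)⁻¹)) :=
      (((he.mul_const _).const_add 1).inv₀ (by simp)).const_mul _
    simpa using this
  have : |s| ^ (2 * m) = (s ^ 2) ^ m := by
    rw [rpow_mul (abs_nonneg s)]; simp
  rw [this]
  exact h1.rpow_const (Or.inr hm)

lemma tendsto_truncTest (hm : 0 ≤ m) {e : ℕ → ℝ} (he : Tendsto e atTop (𝓝 0)) (s : ℝ) :
    Tendsto (fun n => truncTest m (e n) s) atTop (𝓝 (s * |s| ^ (2 * m))) := by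
  have hm1 : (1 + m) ≠ 0 := by positivity
  have h1 : Tendsto (fun n => (1 + e n * s ^ 2)⁻¹) atTop (𝓝 (1 + 0 * s ^ 2)⁻¹) :=
    ((he.mul_const _).const_add 1).inv₀ (by simp)
  have := (((tendsto_truncPow hm he s).mul ((h1.const_mul m).const_add 1)).div_const
    (1 + m)).const_mul s
  have e1 : s * (|s| ^ (2 * m) * (1 + m * (1 + 0 * s ^ 2)⁻¹) / (1 + m)) = s * |s| ^ (2 * m) := by
    simp [hm1]
  rw [e1] at this
  exact this

end Truncation

lemma hasGradientAt_comp_norm_sq {d : ℕ} {H : ℝ → ℝ} {h : ℝ} {x : EuclideanSpace ℝ (Fin d)}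
    (hH : HasDerivAt H h (‖x‖ ^ 2)) :
    HasGradientAt (fun y : EuclideanSpace ℝ (Fin d) => H (‖y‖ ^ 2)) ((2 * h) • x) x := by
  rw [hasGradientAt_iff_hasFDerivAt]
  refine (hH.comp_hasFDerivAt x (hasStrictFDerivAt_norm_sq x).hasFDerivAt).congr_fderiv ?_
  ext v
  simp
  ring

lemma hasDerivAt_max_zero_sq (y : ℝ) :
    HasDerivAt (fun y : ℝ => (max 0 y) ^ 2) (2 * max 0 y) y := by
  rcases lt_trichotomy y 0 with h | rfl | h
  · have : (fun y : ℝ => (max 0 y) ^ 2) =ᶠ[𝓝 y] fun _ => 0 := by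
      filter_upwards [gt_mem_nhds h] with z hz
      simp [max_eq_left hz.le]
    rw [max_eq_left h.le, mul_zero]
    exact (hasDerivAt_const y (0 : ℝ)).congr_of_eventuallyEq this
  · have := hasDerivAt_mul_self_zero (h := fun s : ℝ => max 0 s) (by fun_prop)
    rw [max_self] at this
    rw [max_self, mul_zero]
    refine this.congr_of_eventuallyEq (Eventually.of_forall fun z => ?_)
    rcases le_total z 0 with hz | hz
    · simp [max_eq_left hz]
    · simp [max_eq_right hz, sq]
  · have : (fun y : ℝ => (max 0 y) ^ 2) =ᶠ[𝓝 y] fun z => z ^ 2 := by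
      filter_upwards [lt_mem_nhds h] with z hz
      simp [max_eq_right hz.le]
    rw [max_eq_right h.le]
    refine (HasDerivAt.congr_of_eventuallyEq ?_ this)
    simpa using hasDerivAt_pow 2 y

lemma one_le_jap {d : ℕ} {k : ℝ} (hk : 0 < k) (x : EuclideanSpace ℝ (Fin d)) : 1 ≤ jap k x := by
  unfold jap
  exact one_le_rpow (by nlinarith [sq_nonneg ‖x‖]) (by positivity)

lemma contDiff_jap {d : ℕ} (k : ℝ) {n : WithTop ℕ∞} :
    ContDiff ℝ n (jap k : EuclideanSpace ℝ (Fin d) → ℝ) := by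
  unfold jap
  refine ContDiff.rpow_const_of_ne (contDiff_const.add (contDiff_norm_sq ℝ)) fun x => ?_
  positivity

lemma continuous_jap {d : ℕ} (k : ℝ) : Continuous (jap k : EuclideanSpace ℝ (Fin d) → ℝ) :=
  (contDiff_jap k (n := 0)).continuous

/-- The radial cutoff `(1 - |x|²/R²)₊²`. -/
def radCut {d : ℕ} (R : ℝ) (x : EuclideanSpace ℝ (Fin d)) : ℝ :=
  (max 0 (1 - ‖x‖ ^ 2 / R ^ 2)) ^ 2

/-- The radial slope of `radCut`: its gradient is `radCutSlope R x • x`. -/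
def radCutSlope {d : ℕ} (R : ℝ) (x : EuclideanSpace ℝ (Fin d)) : ℝ :=
  -(4 * max 0 (1 - ‖x‖ ^ 2 / R ^ 2) / R ^ 2)

lemma continuous_radCut {d : ℕ} (R : ℝ) :
    Continuous (radCut R : EuclideanSpace ℝ (Fin d) → ℝ) := by
  unfold radCut; fun_prop

lemma continuous_radCutSlope {d : ℕ} (R : ℝ) :
    Continuous (radCutSlope R : EuclideanSpace ℝ (Fin d) → ℝ) := by
  unfold radCutSlope; fun_prop

lemma radCut_nonneg {d : ℕ} (R : ℝ) (x : EuclideanSpace ℝ (Fin d)) : 0 ≤ radCut R x :=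
  sq_nonneg _

lemma radCut_le_one {d : ℕ} (R : ℝ) (x : EuclideanSpace ℝ (Fin d)) : radCut R x ≤ 1 := by
  unfold radCut
  refine pow_le_one₀ (le_max_left _ _) (max_le zero_le_one ?_)
  have : 0 ≤ ‖x‖ ^ 2 / R ^ 2 := by positivity
  linarith

lemma max_radial_eq_zero {d : ℕ} {R : ℝ} (hR : 0 < R) {x : EuclideanSpace ℝ (Fin d)}
    (hx : R ≤ ‖x‖) : max 0 (1 - ‖x‖ ^ 2 / R ^ 2) = 0 := by
  refine max_eq_left ?_
  have : 1 ≤ ‖x‖ ^ 2 / R ^ 2 := by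
    rw [le_div_iff₀ (by positivity), one_mul]
    gcongr
  linarith

lemma hasCompactSupport_radCut {d : ℕ} {R : ℝ} (hR : 0 < R) :
    HasCompactSupport (radCut R : EuclideanSpace ℝ (Fin d) → ℝ) := by
  refine HasCompactSupport.intro (isCompact_closedBall 0 R) fun x hx => ?_
  rw [Metric.mem_closedBall, dist_zero_right, not_le] at hx
  simp [radCut, max_radial_eq_zero hR hx.le]

lemma hasCompactSupport_radCutSlope {d : ℕ} {R : ℝ} (hR : 0 < R) :
    HasCompactSupport (radCutSlope R : EuclideanSpace ℝ (Fin d) → ℝ) := by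
  refine HasCompactSupport.intro (isCompact_closedBall 0 R) fun x hx => ?_
  rw [Metric.mem_closedBall, dist_zero_right, not_le] at hx
  simp [radCutSlope, max_radial_eq_zero hR hx.le]

lemma abs_radCutSlope_le {d : ℕ} {R : ℝ} (hR : 1 ≤ R) (x : EuclideanSpace ℝ (Fin d)) :
    |radCutSlope R x| * (1 + ‖x‖ ^ 2) ≤ 8 := by
  have hR0 : 0 < R := by linarith
  rcases le_total R ‖x‖ with h | h
  · simp [radCutSlope, max_radial_eq_zero hR0 h]
  · have h1 : max 0 (1 - ‖x‖ ^ 2 / R ^ 2) ≤ 1 := by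
      refine max_le zero_le_one ?_
      have : 0 ≤ ‖x‖ ^ 2 / R ^ 2 := by positivity
      linarith
    have h0 : 0 ≤ max 0 (1 - ‖x‖ ^ 2 / R ^ 2) := le_max_left _ _
    have h2 : ‖x‖ ^ 2 ≤ R ^ 2 := by gcongr
    have h3 : 1 ≤ R ^ 2 := one_le_pow₀ hR
    unfold radCutSlope
    rw [abs_neg, abs_of_nonneg (by positivity), div_mul_eq_mul_div, div_le_iff₀ (by positivity)]
    nlinarith [mul_le_mul h1 h2 (by positivity) (by norm_num), mul_nonneg h0 (sq_nonneg ‖x‖)]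

lemma tendsto_radCut {d : ℕ} (x : EuclideanSpace ℝ (Fin d)) :
    Tendsto (fun n : ℕ => radCut ((n : ℝ) + 1) x) atTop (𝓝 1) := by
  have h1 : Tendsto (fun n : ℕ => ‖x‖ ^ 2 / ((n : ℝ) + 1) ^ 2) atTop (𝓝 0) :=
    ((tendsto_pow_atTop two_ne_zero).comp
      (tendsto_atTop_add_const_right _ 1 tendsto_natCast_atTop_atTop)).const_div_atTop _
  have h2 : Tendsto (fun n : ℕ => (max 0 (1 - ‖x‖ ^ 2 / ((n : ℝ) + 1) ^ 2)) ^ 2) atTop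
      (𝓝 ((max 0 (1 - 0)) ^ 2)) := (tendsto_const_nhds.max (tendsto_const_nhds.sub h1)).pow 2
  simpa [radCut] using h2

lemma tendsto_radCutSlope {d : ℕ} (x : EuclideanSpace ℝ (Fin d)) :
    Tendsto (fun n : ℕ => radCutSlope ((n : ℝ) + 1) x) atTop (𝓝 0) := by
  have h0 : Tendsto (fun n : ℕ => ((n : ℝ) + 1) ^ 2) atTop atTop := (tendsto_pow_atTop two_ne_zero).comp
      (tendsto_atTop_add_const_right _ 1 tendsto_natCast_atTop_atTop)
  have h1 : Tendsto (fun n : ℕ => ‖x‖ ^ 2 / ((n : ℝ) + 1) ^ 2) atTop (𝓝 0) := h0.const_div_atTop _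
  have h2 : Tendsto (fun n : ℕ => 4 * (max 0 (1 - ‖x‖ ^ 2 / ((n : ℝ) + 1) ^ 2))) atTop
      (𝓝 (4 * (max 0 (1 - 0)))) :=
    (tendsto_const_nhds.max (tendsto_const_nhds.sub h1)).const_mul 4
  simpa [radCutSlope] using (h2.div_atTop h0).neg

/-- The gradient of the cut-off weight is radial. -/
lemma hasGradientAt_radCut_mul_jap {d : ℕ} (R k : ℝ) (x : EuclideanSpace ℝ (Fin d)) :
    HasGradientAt (fun y => radCut R y * jap k y)
      ((radCut R x * (k / (1 + ‖x‖ ^ 2)) * jap k x + radCutSlope R x * jap k x) • x) x := by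
  have hpos : 0 < 1 + ‖x‖ ^ 2 := by positivity
  have h1 : HasDerivAt (fun r : ℝ => (max 0 (1 - r / R ^ 2)) ^ 2)
      (2 * max 0 (1 - ‖x‖ ^ 2 / R ^ 2) * -(1 / R ^ 2)) (‖x‖ ^ 2) :=
    (hasDerivAt_max_zero_sq _).comp (‖x‖ ^ 2) (((hasDerivAt_id _).div_const (R ^ 2)).const_sub 1)
  have h2 : HasDerivAt (fun r : ℝ => (1 + r) ^ (k / 2))
      (1 * (k / 2) * (1 + ‖x‖ ^ 2) ^ (k / 2 - 1)) (‖x‖ ^ 2) :=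
    ((hasDerivAt_id _).const_add 1).rpow_const (Or.inl hpos.ne')
  have h3 := hasGradientAt_comp_norm_sq (h1.mul h2)
  have e : (radCut R x * (k / (1 + ‖x‖ ^ 2)) * jap k x + radCutSlope R x * jap k x)
      = 2 * (2 * max 0 (1 - ‖x‖ ^ 2 / R ^ 2) * -(1 / R ^ 2) * (1 + ‖x‖ ^ 2) ^ (k / 2) +
        (max 0 (1 - ‖x‖ ^ 2 / R ^ 2)) ^ 2 * (1 * (k / 2) * (1 + ‖x‖ ^ 2) ^ (k / 2 - 1))) := by
    rw [rpow_sub_one hpos.ne']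
    unfold radCut radCutSlope jap
    ring
  rw [e]
  exact h3

lemma hasGradientAt_comp_mul {d : ℕ} {Φ : ℝ → ℝ} {Φ' : ℝ} {φ η : EuclideanSpace ℝ (Fin d) → ℝ}
    {x z : EuclideanSpace ℝ (Fin d)} (hΦ : HasDerivAt Φ Φ' (φ x)) (hφ : DifferentiableAt ℝ φ x)
    (hη : HasGradientAt η z x) :
    HasGradientAt (fun y => Φ (φ y) * η y) (Φ (φ x) • z + (Φ' * η x) • gradient φ x) x := by
  rw [hasGradientAt_iff_hasFDerivAt] at hη ⊢
  have h1 := (hΦ.comp_hasFDerivAt x hφ.hasGradientAt.hasFDerivAt).mul hη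
  refine h1.congr_fderiv ?_
  ext v
  simp
  ring

lemma measurable_gradient {d : ℕ} (φ : EuclideanSpace ℝ (Fin d) → ℝ) :
    Measurable (gradient φ) := by
  unfold gradient
  exact (LinearIsometryEquiv.continuous _).measurable.comp (measurable_fderiv ℝ φ)

/-- Multiplying an `L²` field by a continuous compactly supported function stays in `L²`. -/
lemma memLp_smul_of_hasCompactSupport {d : ℕ} {V : Type*} [NormedAddCommGroup V]
    [NormedSpace ℝ V] {c : EuclideanSpace ℝ (Fin d) → ℝ} {F : EuclideanSpace ℝ (Fin d) → V}
    (hc : Continuous c) (hcs : HasCompactSupport c) (hF : MemLp F 2 volume) :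
    MemLp (fun x => c x • F x) 2 volume := by
  obtain ⟨C, hC⟩ := hc.bounded_above_of_compact_support hcs
  refine hF.of_le_mul (c := C) (hc.aestronglyMeasurable.smul hF.aestronglyMeasurable)
    (Eventually.of_forall fun x => ?_)
  rw [norm_smul]
  gcongr
  exact hC x

/-- Cutting off a nonlinear function of an `H¹` function gives an admissible test function. -/
lemma comp_mul_admissible {d : ℕ} {Φ Φ' : ℝ → ℝ} {φ η σ : EuclideanSpace ℝ (Fin d) → ℝ}
    (hΦ : ∀ s, HasDerivAt Φ (Φ' s) s) (hΦ' : Continuous Φ') (hφ : Differentiable ℝ φ)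
    (hφ' : MemLp (gradient φ) 2 volume)
    (hη : ∀ x, HasGradientAt η (σ x • x) x) (hηs : HasCompactSupport η)
    (hσ : Continuous σ) (hσs : HasCompactSupport σ) :
    Differentiable ℝ (fun x => Φ (φ x) * η x) ∧ HasCompactSupport (fun x => Φ (φ x) * η x) ∧
    MemLp (gradient fun x => Φ (φ x) * η x) 2 volume ∧
    ∀ x, gradient (fun x => Φ (φ x) * η x) x
      = Φ (φ x) • σ x • x + (Φ' (φ x) * η x) • gradient φ x := by
  have hg := fun x => hasGradientAt_comp_mul (hΦ (φ x)) (hφ x) (hη x)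
  have hηd : Differentiable ℝ η := fun x => (hη x).differentiableAt
  have hΦc : Continuous Φ := (show Differentiable ℝ Φ from
    fun s => (hΦ s).differentiableAt).continuous
  have e : (gradient fun x => Φ (φ x) * η x)
      = fun x => Φ (φ x) • σ x • x + (Φ' (φ x) * η x) • gradient φ x :=
    funext fun x => (hg x).gradient
  refine ⟨fun x => (hg x).differentiableAt, hηs.mul_left, ?_, fun x => (hg x).gradient⟩
  rw [e]
  refine MemLp.add ?_ ?_
  · refine Continuous.memLp_of_hasCompactSupport ?_ ?_
    · have := hφ.continuous
      fun_prop
    · refine hσs.mono fun x hx h0 => hx ?_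
      simp [h0]
  · exact memLp_smul_of_hasCompactSupport
      ((hΦ'.comp hφ.continuous).mul hηd.continuous) hηs.mul_left hφ'

lemma gradient_eq_zero_of_notMem {d : ℕ} {u : EuclideanSpace ℝ (Fin d) → ℝ}
    {x : EuclideanSpace ℝ (Fin d)} (hx : x ∉ tsupport u) : gradient u x = 0 := by
  rw [gradient, fderiv_of_notMem_tsupport ℝ hx, map_zero]

/-- A locally bounded `E` pairs integrably with the gradient of a test function. -/
lemma integrable_inner_gradient {d : ℕ} {f : EuclideanSpace ℝ (Fin d) → ℝ}
    {E : EuclideanSpace ℝ (Fin d) → EuclideanSpace ℝ (Fin d)} (hE : Continuous E)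
    (hfs : HasCompactSupport f) (hf' : MemLp (gradient f) 2 volume)
    {c : EuclideanSpace ℝ (Fin d) → ℝ} (hcm : AEStronglyMeasurable c volume)
    (hc : ∀ x, |c x| ≤ ‖gradient f x‖ * ‖E x‖) : Integrable c := by
  obtain ⟨C, hC⟩ := hfs.isCompact.exists_bound_of_continuousOn hE.continuousOn
  have hK := (hf'.locallyIntegrable (by norm_num)).integrableOn_isCompact hfs.isCompact
  have hi : Integrable ((tsupport f).indicator fun x => ‖gradient f x‖ * C) := by
    rw [integrable_indicator_iff (isClosed_tsupport f).measurableSet]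
    exact hK.norm.mul_const C
  refine hi.mono' hcm (Eventually.of_forall fun x => ?_)
  by_cases hx : x ∈ tsupport f
  · rw [Set.indicator_of_mem hx]
    exact (hc x).trans (by gcongr; exact hC x hx)
  · rw [Set.indicator_of_notMem hx]
    have := hc x
    rw [gradient_eq_zero_of_notMem hx] at this
    simpa using this

/-- Integration by parts against the divergence. -/
lemma integral_mul_dvg {d : ℕ} {f : EuclideanSpace ℝ (Fin d) → ℝ}
    {E : EuclideanSpace ℝ (Fin d) → EuclideanSpace ℝ (Fin d)} (hE : H0 E)
    (hf : Differentiable ℝ f) (hfs : HasCompactSupport f) (hf' : MemLp (gradient f) 2 volume) :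
    Integrable (fun x => f x * dvg E x) ∧ Integrable (fun x => ⟪gradient f x, E x⟫) ∧
    ∫ x, f x * dvg E x = -∫ x, ⟪gradient f x, E x⟫ := by
  obtain ⟨hEd, hEb⟩ := hE
  have hEc := hEd.continuous
  let e : Fin d → EuclideanSpace ℝ (Fin d) := fun i => EuclideanSpace.single i 1
  have he : ∀ i, ‖e i‖ = 1 := fun i => by simp [e]
  have hEi : ∀ i x, HasFDerivAt (fun y => ⟪E y, e i⟫)
      ((innerSL ℝ (e i)).comp (fderiv ℝ E x)) x := by
    intro i x
    have := (innerSL ℝ (e i)).hasFDerivAt.comp x (hEd x).hasFDerivAt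
    refine this.congr_of_eventuallyEq (Eventually.of_forall fun y => ?_)
    simp [real_inner_comm]
  have hfe : ∀ i x, fderiv ℝ f x (e i) = ⟪gradient f x, e i⟫ := by
    intro i x
    rw [gradient, InnerProductSpace.toDual_symm_apply]
  have hEm : Measurable (fderiv ℝ E) := measurable_fderiv ℝ E
  have i1 : ∀ i, Integrable (fun x => fderiv ℝ f x (e i) * ⟪E x, e i⟫) := by
    intro i
    refine integrable_inner_gradient hEc hfs hf' ?_ fun x => ?_
    · refine AEStronglyMeasurable.mul ?_ (by fun_prop)
      exact (measurable_fderiv_apply_const ℝ f (e i)).aestronglyMeasurable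
    · rw [hfe, abs_mul]
      have a1 := abs_real_inner_le_norm (gradient f x) (e i)
      have a2 := abs_real_inner_le_norm (E x) (e i)
      rw [he, mul_one] at a1 a2
      gcongr
  obtain ⟨R, hR⟩ := hfs.isCompact.isBounded.subset_closedBall (0 : EuclideanSpace ℝ (Fin d))
  obtain ⟨C, hC⟩ := hEb R
  have hfi : Integrable f := hf.continuous.integrable_of_hasCompactSupport hfs
  have i2 : ∀ i, Integrable (fun x => f x * ((innerSL ℝ (e i)).comp (fderiv ℝ E x)) (e i)) := by
    intro i
    refine (hfi.norm.mul_const C).mono' ?_ (Eventually.of_forall fun x => ?_)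
    · refine hfi.aestronglyMeasurable.mul ?_
      have : Measurable fun x => ⟪e i, fderiv ℝ E x (e i)⟫ :=
        measurable_const.inner (measurable_fderiv_apply_const ℝ E (e i))
      exact this.aestronglyMeasurable
    · rw [norm_mul]
      by_cases hx : x ∈ tsupport f
      · gcongr
        have hx' := hR hx
        rw [Metric.mem_closedBall, dist_zero_right] at hx'
        have b1 := hC x hx'
        have b2 : |⟪e i, fderiv ℝ E x (e i)⟫| ≤ ‖fderiv ℝ E x‖ := by
          have c1 := abs_real_inner_le_norm (e i) (fderiv ℝ E x (e i))
          have c2 := (fderiv ℝ E x).le_opNorm (e i)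
          rw [he] at c1 c2
          linarith
        have b3 := norm_nonneg (E x)
        simp only [ContinuousLinearMap.comp_apply, innerSL_apply_apply, Real.norm_eq_abs]
        linarith
      · simp [image_eq_zero_of_notMem_tsupport hx]
  have i3 : ∀ i, Integrable (fun x => f x * ⟪E x, e i⟫) := fun i =>
    (hf.continuous.mul (hEc.inner continuous_const)).integrable_of_hasCompactSupport hfs.mul_right
  have key : ∀ i, ∫ x, f x * ((innerSL ℝ (e i)).comp (fderiv ℝ E x)) (e i)
      = -∫ x, fderiv ℝ f x (e i) * ⟪E x, e i⟫ := fun i =>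
    integral_bilinear_hasFDerivAt_right_eq_neg_left_of_integrable
      (B := ContinuousLinearMap.mul ℝ ℝ) (v := e i) (μ := volume)
      (f := f) (g := fun y => ⟪E y, e i⟫) (f' := fderiv ℝ f) (i1 i) (i2 i) (i3 i)
      (fun x _ => (hf x).hasFDerivAt) (fun x _ => hEi i x)
  have s1 : (fun x => f x * dvg E x)
      = fun x => ∑ i, f x * ((innerSL ℝ (e i)).comp (fderiv ℝ E x)) (e i) := by
    ext x
    rw [dvg, Finset.mul_sum]
    refine Finset.sum_congr rfl fun i _ => ?_
    simp only [ContinuousLinearMap.comp_apply, innerSL_apply_apply, e]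
    rw [real_inner_comm]
  have s2 : (fun x => ⟪gradient f x, E x⟫)
      = fun x => ∑ i, fderiv ℝ f x (e i) * ⟪E x, e i⟫ := by
    ext x
    rw [← (EuclideanSpace.basisFun (Fin d) ℝ).sum_inner_mul_inner (gradient f x) (E x)]
    refine Finset.sum_congr rfl fun i _ => ?_
    rw [hfe, EuclideanSpace.basisFun_apply, real_inner_comm (E x)]
  refine ⟨?_, ?_, ?_⟩
  · rw [s1]; exact integrable_finsetSum _ fun i _ => i2 i
  · rw [s2]; exact integrable_finsetSum _ fun i _ => i1 i
  · rw [s1, s2, integral_finsetSum _ fun i _ => i2 i, integral_finsetSum _ fun i _ => i1 i,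
      ← Finset.sum_neg_distrib]
    exact Finset.sum_congr rfl fun i _ => key i

/-- Young's inequality for a test function of growth at most `p - 1`. -/
lemma mul_test_le {p s f b : ℝ} (hp : 2 ≤ p) (hsb : 0 ≤ s * b) (hbp : |b| ≤ |s| ^ (p - 1)) :
    f * b ≤ |f| ^ p / p + (1 - 1 / p) * (s * b) := by
  have hp0 : 0 < p := by linarith
  have hp1 : 0 < p - 1 := by linarith
  have hpq : p.HolderConjugate (p / (p - 1)) := by
    rw [Real.holderConjugate_iff]
    refine ⟨by linarith, ?_⟩
    field_simp
    ring
  have h1 := Real.young_inequality f b hpq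
  have h2 : |b| ^ (p / (p - 1)) ≤ s * b := by
    have e1 : p / (p - 1) = 1 + (p - 1)⁻¹ := by field_simp; ring
    have e2 : |b| ^ ((p - 1)⁻¹) ≤ |s| := by
      calc |b| ^ ((p - 1)⁻¹) ≤ (|s| ^ (p - 1)) ^ ((p - 1)⁻¹) :=
            rpow_le_rpow (abs_nonneg b) hbp (by positivity)
        _ = |s| := by rw [← rpow_mul (abs_nonneg s), mul_inv_cancel₀ hp1.ne', rpow_one]
    rw [e1, rpow_add_of_nonneg (abs_nonneg b) zero_le_one (by positivity), rpow_one]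
    calc |b| * |b| ^ ((p - 1)⁻¹) ≤ |b| * |s| := by gcongr
      _ = |s * b| := by rw [abs_mul, mul_comm]
      _ = s * b := abs_of_nonneg hsb
  have h3 : |b| ^ (p / (p - 1)) / (p / (p - 1)) ≤ (1 - 1 / p) * (s * b) := by
    have e3 : (1 - 1 / p) = (p / (p - 1))⁻¹ := by field_simp
    rw [e3, div_eq_mul_inv, mul_comm]
    gcongr
  linarith

/-- Pointwise coercivity of the integrand obtained by testing with a truncated power. -/
lemma pointwise_coercivity {lam k p C₀ β₀ s f b b' G D a r N y u χ τ w : ℝ}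
    (hp : 2 ≤ p) (hk : 0 < k) (hC₀ : 0 ≤ C₀)
    (hlam : 1 + |β₀| + k * C₀ + k ^ 2 / 2 ≤ lam)
    (hG0 : 0 ≤ G) (hGle : G ≤ s * b) (hb2 : b ^ 2 ≤ b' * (s * b)) (hb' : 0 ≤ b')
    (hbp : |b| ≤ |s| ^ (p - 1)) (ha : a = 1 + r ^ 2) (hN : 0 ≤ N)
    (hy : |y| ≤ N * r) (hu : |u| ≤ C₀ * a) (hD : β₀ ≤ -(p - 1) * D + k * u / a)
    (hχ : 0 ≤ χ) (hw : 0 ≤ w) :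
    χ * ((s * b / p + b' * N ^ 2 / 2 - |f| ^ p / p) * w)
      - |τ| * a * ((|b| * N + C₀ * (s * b)) * w) ≤
    (lam * s - f) * (b * (χ * w)) + b' * (χ * w) * N ^ 2
      + b * (χ * (k / a) * w + τ * w) * y
      + (s * b - G) * (χ * (k / a) * w + τ * w) * u - G * (χ * w) * D := by
  have ha0 : 0 < a := by rw [ha]; positivity
  have hra : r ≤ a := by rw [ha]; nlinarith [sq_nonneg (r - 1)]
  have hT : 0 ≤ s * b := hG0.trans hGle
  obtain ⟨κ, hκ⟩ : ∃ κ, κ = u / a := ⟨_, rfl⟩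
  have huκ : u = κ * a := by rw [hκ]; field_simp
  have hκ1 : |κ| ≤ C₀ := by
    rw [hκ, abs_div, abs_of_pos ha0, div_le_iff₀ ha0]; exact hu
  have hD' : β₀ ≤ -(p - 1) * D + k * κ := by rw [hκ]; convert hD using 2; ring
  have hya : |y / a| ≤ N := by
    rw [abs_div, abs_of_pos ha0, div_le_iff₀ ha0]
    exact hy.trans (by gcongr)
  have e1 := mul_test_le (f := f) hp hT hbp
  have e2 : -(b' * N ^ 2 / 2 + k ^ 2 * (s * b) / 2) ≤ b * k * (y / a) := by
    have h1 : |b * k * (y / a)| ≤ |b| * k * N := by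
      rw [abs_mul, abs_mul, abs_of_pos hk]; gcongr
    have h2 : |b| * k * N ≤ b' * N ^ 2 / 2 + k ^ 2 * (s * b) / 2 := by
      refine le_of_sq_le_sq ?_ (by positivity)
      have h3 : (|b| * k * N) ^ 2 = b ^ 2 * (k ^ 2 * N ^ 2) := by
        rw [mul_pow, mul_pow, sq_abs]; ring
      rw [h3]
      nlinarith [mul_le_mul_of_nonneg_right hb2 (show 0 ≤ k ^ 2 * N ^ 2 by positivity),
        sq_nonneg (b' * N ^ 2 - k ^ 2 * (s * b))]
    linarith [neg_abs_le (b * k * (y / a))]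
  have e3 : -(|τ| * a * (|b| * N)) ≤ b * τ * y := by
    have h1 : |b * τ * y| ≤ |b| * |τ| * (N * a) := by
      rw [abs_mul, abs_mul]; gcongr; exact hy.trans (by gcongr)
    linarith [neg_abs_le (b * τ * y)]
  have e4 : -(|τ| * a * (C₀ * (s * b))) ≤ (s * b - G) * τ * u := by
    have h1 : |(s * b - G) * τ * u| ≤ (s * b) * |τ| * (C₀ * a) := by
      rw [abs_mul, abs_mul, abs_of_nonneg (by linarith : 0 ≤ s * b - G)]
      gcongr; linarith
    linarith [neg_abs_le ((s * b - G) * τ * u)]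
  have e5 : -((|β₀| + k * C₀) * (s * b)) ≤ (s * b - G) * (k * κ) - G * D := by
    have h0 : |k * κ| ≤ k * C₀ := by rw [abs_mul, abs_of_pos hk]; gcongr
    have hM : D ≤ |β₀| + k * C₀ := by
      by_contra hcon
      push Not at hcon
      have hM0 : 0 ≤ |β₀| + k * C₀ := by positivity
      nlinarith [neg_abs_le β₀, le_abs_self (k * κ), mul_nonneg (by linarith : 0 ≤ p - 2)
        (by linarith : 0 ≤ D)]
    linarith [mul_le_mul_of_nonneg_left hM hG0,
      mul_nonneg (by linarith : 0 ≤ s * b - G) (by linarith [neg_abs_le (k * κ)] :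
        0 ≤ k * κ + k * C₀), mul_nonneg (by linarith : 0 ≤ s * b - G) (abs_nonneg β₀)]
  have e6 : (1 + |β₀| + k * C₀ + k ^ 2 / 2) * (s * b) ≤ lam * (s * b) := by gcongr
  have main : s * b / p + b' * N ^ 2 / 2 - |f| ^ p / p ≤
      lam * (s * b) - f * b + b' * N ^ 2 + b * k * (y / a) + ((s * b - G) * (k * κ) - G * D) := by
    have : (1 - 1 / p) * (s * b) = s * b - s * b / p := by ring
    linarith
  have main2 := mul_le_mul_of_nonneg_left main (mul_nonneg hχ hw)
  have main3 := mul_le_mul_of_nonneg_left (add_le_add e3 e4) hw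
  have e7 : (lam * s - f) * (b * (χ * w)) + b' * (χ * w) * N ^ 2
      + b * (χ * (k / a) * w + τ * w) * y
      + (s * b - G) * (χ * (k / a) * w + τ * w) * u - G * (χ * w) * D
      = χ * w * (lam * (s * b) - f * b + b' * N ^ 2 + b * k * (y / a)
        + ((s * b - G) * (k * κ) - G * D)) + w * (b * τ * y + (s * b - G) * τ * u) := by
    rw [hκ]; ring
  rw [e7]
  linarith

/-- **Fatou's lemma** for nonnegative integrable functions with bounded integrals. -/
lemma integrable_of_tendsto_of_integral_le {α : Type*} [MeasurableSpace α] {μ : Measure α}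
    {F : ℕ → α → ℝ} {f : α → ℝ} {C : ℝ} (hF : ∀ n, Integrable (F n) μ)
    (hF0 : ∀ n x, 0 ≤ F n x) (hlim : ∀ x, Tendsto (fun n => F n x) atTop (𝓝 (f x)))
    (hC : ∀ n, ∫ x, F n x ∂μ ≤ C) : Integrable f μ ∧ ∫ x, f x ∂μ ≤ C := by
  have hf0 : ∀ x, 0 ≤ f x := fun x => ge_of_tendsto' (hlim x) fun n => hF0 n x
  have hfm : AEStronglyMeasurable f μ :=
    aestronglyMeasurable_of_tendsto_ae atTop (fun n => (hF n).aestronglyMeasurable)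
      (Eventually.of_forall hlim)
  have hC0 : 0 ≤ C := (integral_nonneg (hF0 0)).trans (hC 0)
  have h1 : ∫⁻ x, ENNReal.ofReal (f x) ∂μ ≤ ENNReal.ofReal C := by
    calc ∫⁻ x, ENNReal.ofReal (f x) ∂μ
        = ∫⁻ x, liminf (fun n => ENNReal.ofReal (F n x)) atTop ∂μ := by
          refine lintegral_congr fun x => ?_
          exact ((ENNReal.continuous_ofReal.tendsto _).comp (hlim x)).liminf_eq.symm
      _ ≤ liminf (fun n => ∫⁻ x, ENNReal.ofReal (F n x) ∂μ) atTop :=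
          lintegral_liminf_le' fun n => (hF n).aestronglyMeasurable.aemeasurable.ennreal_ofReal
      _ ≤ liminf (fun _ : ℕ => ENNReal.ofReal C) atTop := by
          refine liminf_le_liminf (Eventually.of_forall fun n => ?_)
          rw [← ofReal_integral_eq_lintegral_ofReal (hF n) (Eventually.of_forall (hF0 n))]
          exact ENNReal.ofReal_le_ofReal (hC n)
      _ = ENNReal.ofReal C := liminf_const _
  refine ⟨⟨hfm, ?_⟩, ?_⟩
  · rw [hasFiniteIntegral_iff_ofReal (Eventually.of_forall hf0)]
    exact h1.trans_lt ENNReal.ofReal_lt_top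
  · rw [integral_eq_lintegral_of_nonneg_ae (Eventually.of_forall hf0) hfm]
    exact ENNReal.toReal_le_of_le_ofReal hC0 h1

lemma integrable_inner_of_memLp_two {d : ℕ} {V : Type*} [NormedAddCommGroup V]
    [InnerProductSpace ℝ V] {F h : EuclideanSpace ℝ (Fin d) → V}
    (hF : MemLp F 2 volume) (hh : MemLp h 2 volume) : Integrable fun x => ⟪F x, h x⟫ := by
  refine (hF.norm.integrable_mul hh.norm).mono'
    (hF.aestronglyMeasurable.inner hh.aestronglyMeasurable) (Eventually.of_forall fun x => ?_)
  exact abs_real_inner_le_norm _ _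

/-- The weighted energy estimate for a truncated power of a weak solution. -/
lemma truncated_energy_estimate {d : ℕ} {k p C₀ β₀ lam : ℝ} (hk : 0 < k) (hp : 2 ≤ p)
    (hC₀ : 0 ≤ C₀) (hlam : 1 + |β₀| + k * C₀ + k ^ 2 / 2 ≤ lam)
    {E : EuclideanSpace ℝ (Fin d) → EuclideanSpace ℝ (Fin d)} (hE : H0 E)
    (hu : ∀ x, |⟪x, E x⟫| ≤ C₀ * (1 + ‖x‖ ^ 2))
    (hE2 : ∀ x, β₀ ≤ -(p - 1) * dvg E x + k * ⟪x, E x⟫ / (1 + ‖x‖ ^ 2))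
    {f₀ φ : EuclideanSpace ℝ (Fin d) → ℝ}
    (hfp : Integrable fun x => |f₀ x| ^ p * jap k x)
    (hA : MemLp (fun x => lam * φ x - f₀ x) 2 volume)
    (hφ : Differentiable ℝ φ) (hφ2 : Integrable fun x => φ x ^ 2 * jap k x)
    (hφ'2 : Integrable fun x => ‖gradient φ x‖ ^ 2 * jap k x)
    (hφ' : MemLp (gradient φ) 2 volume)
    (hF : ∀ R : ℝ, MemLp
      ((Metric.closedBall 0 R).indicator fun x => gradient φ x + φ x • E x) 2 volume)
    (hw : ∀ ψ : EuclideanSpace ℝ (Fin d) → ℝ, ContDiff ℝ (⊤ : ℕ∞) ψ → HasCompactSupport ψ →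
      (∫ x, ⟪lam * φ x - f₀ x, ψ x⟫) + ∫ x, ⟪gradient φ x + φ x • E x, gradient ψ x⟫ = 0)
    {b b' G : ℝ → ℝ} (hb : ∀ s, HasDerivAt b (b' s) s) (hb'c : Continuous b')
    (hG : ∀ s, HasDerivAt G (s * b' s) s) (hG0 : ∀ s, 0 ≤ G s) (hGle : ∀ s, G s ≤ s * b s)
    (hb2 : ∀ s, b s ^ 2 ≤ b' s * (s * b s)) (hb'0 : ∀ s, 0 ≤ b' s)
    (hbp : ∀ s, |b s| ≤ |s| ^ (p - 1)) {C : ℝ} (hb'C : ∀ s, b' s ≤ C)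
    (hbC : ∀ s, |b s| ≤ C * |s|) :
    Integrable (fun x => φ x * b (φ x) * jap k x) ∧
    Integrable (fun x => b' (φ x) * ‖gradient φ x‖ ^ 2 * jap k x) ∧
    (∫ x, φ x * b (φ x) * jap k x) / p
      + (∫ x, b' (φ x) * ‖gradient φ x‖ ^ 2 * jap k x) / 2
      ≤ (∫ x, |f₀ x| ^ p * jap k x) / p := by
  have hC : 0 ≤ C := (hb'0 0).trans (hb'C 0)
  have hφc := hφ.continuous
  have hbc : Continuous b :=
    (show Differentiable ℝ b from fun s => (hb s).differentiableAt).continuous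
  have hw0 : ∀ x : EuclideanSpace ℝ (Fin d), 0 ≤ jap k x :=
    fun x => zero_le_one.trans (one_le_jap hk x)
  have hjc : Continuous (jap k : EuclideanSpace ℝ (Fin d) → ℝ) := continuous_jap k
  have hgm : AEStronglyMeasurable (fun x => ‖gradient φ x‖) volume :=
    (measurable_gradient φ).norm.aestronglyMeasurable
  have hsb : ∀ s, 0 ≤ s * b s := fun s => (hG0 s).trans (hGle s)
  have i1 : Integrable (fun x => φ x * b (φ x) * jap k x) := by
    refine (hφ2.const_mul C).mono' (by fun_prop) (Eventually.of_forall fun x => ?_)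
    rw [Real.norm_eq_abs, abs_mul, abs_mul, abs_of_nonneg (hw0 x), ← mul_assoc]
    refine mul_le_mul_of_nonneg_right ?_ (hw0 x)
    calc |φ x| * |b (φ x)| ≤ |φ x| * (C * |φ x|) := by gcongr; exact hbC _
      _ = C * φ x ^ 2 := by rw [← sq_abs (φ x)]; ring
  have i2 : Integrable (fun x => b' (φ x) * ‖gradient φ x‖ ^ 2 * jap k x) := by
    refine (hφ'2.const_mul C).mono' ?_ (Eventually.of_forall fun x => ?_)
    · exact ((hb'c.comp hφc).aestronglyMeasurable.mul (hgm.pow 2)).mul hjc.aestronglyMeasurable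
    · rw [Real.norm_eq_abs, abs_of_nonneg
        (mul_nonneg (mul_nonneg (hb'0 _) (sq_nonneg _)) (hw0 x)), mul_assoc]
      gcongr
      · exact mul_nonneg (sq_nonneg _) (hw0 x)
      · exact hb'C _
  have i3 : Integrable (fun x => |b (φ x)| * ‖gradient φ x‖ * jap k x) := by
    refine ((hφ2.add hφ'2).const_mul C).mono' ?_ (Eventually.of_forall fun x => ?_)
    · exact ((hbc.comp hφc).abs.aestronglyMeasurable.mul hgm).mul hjc.aestronglyMeasurable
    · rw [Real.norm_eq_abs, abs_of_nonneg
        (mul_nonneg (mul_nonneg (abs_nonneg _) (norm_nonneg _)) (hw0 x)), Pi.add_apply,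
        ← add_mul, ← mul_assoc]
      refine mul_le_mul_of_nonneg_right ?_ (hw0 x)
      calc |b (φ x)| * ‖gradient φ x‖ ≤ C * |φ x| * ‖gradient φ x‖ := by gcongr; exact hbC _
        _ = C * (|φ x| * ‖gradient φ x‖) := by ring
        _ ≤ C * (φ x ^ 2 + ‖gradient φ x‖ ^ 2) := by
          refine mul_le_mul_of_nonneg_left ?_ hC
          rw [← sq_abs (φ x)]
          nlinarith [sq_nonneg (|φ x| - ‖gradient φ x‖), sq_nonneg (|φ x|),
            sq_nonneg ‖gradient φ x‖]
  let P : EuclideanSpace ℝ (Fin d) → ℝ := fun x =>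
    (φ x * b (φ x) / p + b' (φ x) * ‖gradient φ x‖ ^ 2 / 2 - |f₀ x| ^ p / p) * jap k x
  let Q : EuclideanSpace ℝ (Fin d) → ℝ := fun x =>
    (|b (φ x)| * ‖gradient φ x‖ + C₀ * (φ x * b (φ x))) * jap k x
  have hPe : P = fun x => φ x * b (φ x) * jap k x / p
      + b' (φ x) * ‖gradient φ x‖ ^ 2 * jap k x / 2 - |f₀ x| ^ p * jap k x / p := by
    ext x; simp only [P]; ring
  have hP : Integrable P := by
    rw [hPe]
    exact ((i1.div_const p).add (i2.div_const 2)).sub (hfp.div_const p)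
  have hQ : Integrable Q := by
    have : Q = fun x => |b (φ x)| * ‖gradient φ x‖ * jap k x
        + C₀ * (φ x * b (φ x) * jap k x) := by
      ext x; simp only [Q]; ring
    rw [this]
    exact i3.add (i1.const_mul C₀)
  have hQ0 : ∀ x, 0 ≤ Q x := fun x => mul_nonneg (add_nonneg (by positivity)
    (mul_nonneg hC₀ (hsb _))) (hw0 x)
  let K : ℕ → EuclideanSpace ℝ (Fin d) → ℝ := fun n x =>
    radCut ((n : ℝ) + 1) x * P x - |radCutSlope ((n : ℝ) + 1) x| * (1 + ‖x‖ ^ 2) * Q x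
  have hKm : ∀ n, AEStronglyMeasurable (K n) volume := by
    intro n
    have c1 := continuous_radCut (d := d) ((n : ℝ) + 1)
    have c2 := continuous_radCutSlope (d := d) ((n : ℝ) + 1)
    refine (c1.aestronglyMeasurable.mul hP.aestronglyMeasurable).sub
      (AEStronglyMeasurable.mul ?_ hQ.aestronglyMeasurable)
    have : Continuous fun x : EuclideanSpace ℝ (Fin d) =>
      |radCutSlope ((n : ℝ) + 1) x| * (1 + ‖x‖ ^ 2) := by fun_prop
    exact this.aestronglyMeasurable
  have hbd : Integrable (fun x => ‖P x‖ + 8 * Q x) := hP.norm.add (hQ.const_mul 8)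
  have hKb : ∀ n x, ‖K n x‖ ≤ ‖P x‖ + 8 * Q x := by
    intro n x
    refine (norm_sub_le _ _).trans (add_le_add ?_ ?_)
    · rw [norm_mul, Real.norm_eq_abs, abs_of_nonneg (radCut_nonneg _ x)]
      exact mul_le_of_le_one_left (norm_nonneg _) (radCut_le_one _ x)
    · rw [Real.norm_eq_abs, abs_of_nonneg (mul_nonneg (by positivity) (hQ0 x))]
      exact mul_le_mul_of_nonneg_right
        (abs_radCutSlope_le (by linarith [(Nat.cast_nonneg n : (0 : ℝ) ≤ n)]) x) (hQ0 x)
  have hKi : ∀ n, Integrable (K n) := fun n =>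
    hbd.mono' (hKm n) (Eventually.of_forall (hKb n))
  have hKlim : Tendsto (fun n => ∫ x, K n x) atTop (𝓝 (∫ x, P x)) := by
    refine tendsto_integral_of_dominated_convergence _ hKm hbd
      (fun n => Eventually.of_forall (hKb n)) (Eventually.of_forall fun x => ?_)
    have := ((tendsto_radCut x).mul_const (P x)).sub
      (((tendsto_radCutSlope x).abs.mul_const (1 + ‖x‖ ^ 2)).mul_const (Q x))
    simpa [K] using this
  have hKle : ∀ n, ∫ x, K n x ≤ 0 := by
    intro n
    have hR : (0 : ℝ) < (n : ℝ) + 1 := by positivity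
    set R := (n : ℝ) + 1 with hRdef
    let η : EuclideanSpace ℝ (Fin d) → ℝ := fun x => radCut R x * jap k x
    let σ : EuclideanSpace ℝ (Fin d) → ℝ := fun x =>
      radCut R x * (k / (1 + ‖x‖ ^ 2)) * jap k x + radCutSlope R x * jap k x
    have hη : ∀ x, HasGradientAt η (σ x • x) x := hasGradientAt_radCut_mul_jap R k
    have hηs : HasCompactSupport η := (hasCompactSupport_radCut hR).mul_right
    have hσ : Continuous σ := by
      have c1 := continuous_radCut (d := d) R
      have c2 := continuous_radCutSlope (d := d) R
      have c3 : Continuous fun x : EuclideanSpace ℝ (Fin d) => k / (1 + ‖x‖ ^ 2) :=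
        continuous_const.div (by fun_prop) fun x => by positivity
      exact ((c1.mul c3).mul hjc).add (c2.mul hjc)
    have hσs : HasCompactSupport σ :=
      ((hasCompactSupport_radCut hR).mul_right.mul_right).add
        ((hasCompactSupport_radCutSlope hR).mul_right)
    obtain ⟨g1, g2, g3, g4⟩ := comp_mul_admissible hb hb'c hφ hφ' hη hηs hσ hσs
    obtain ⟨q1, q2, q3, q4⟩ :=
      comp_mul_admissible hG (continuous_id.mul hb'c) hφ hφ' hη hηs hσ hσs
    obtain ⟨d1, d2, d3⟩ := integral_mul_dvg hE q1 q2 q3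
    have w1 := weak_form_extend hA hF hw g1 g2 g3
    have j1 : Integrable fun x => ⟪lam * φ x - f₀ x, b (φ x) * η x⟫ :=
      integrable_inner_of_memLp_two hA (g1.continuous.memLp_of_hasCompactSupport g2)
    have j2 : Integrable fun x => ⟪gradient φ x + φ x • E x,
        gradient (fun x => b (φ x) * η x) x⟫ := by
      have hEc : Continuous fun x => φ x • E x := hφc.smul hE.1.continuous
      have a1 := integrable_inner_of_memLp_two hφ' g3
      have a2 : Integrable fun x => ⟪φ x • E x, gradient (fun x => b (φ x) * η x) x⟫ := by
        refine integrable_inner_gradient hEc g2 g3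
          (hEc.aestronglyMeasurable.inner g3.aestronglyMeasurable) fun x => ?_
        rw [mul_comm]
        exact abs_real_inner_le_norm _ _
      simp only [inner_add_left]
      exact a1.add a2
    have hs1 : Integrable fun x => ⟪lam * φ x - f₀ x, b (φ x) * η x⟫
        + ⟪gradient φ x + φ x • E x, gradient (fun x => b (φ x) * η x) x⟫ := j1.add j2
    have hs2 : Integrable fun x => G (φ x) * η x * dvg E x
        + ⟪gradient (fun x => G (φ x) * η x) x, E x⟫ := d1.add d2
    have total : ∫ x, ((⟪lam * φ x - f₀ x, b (φ x) * η x⟫ + ⟪gradient φ x + φ x • E x,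
        gradient (fun x => b (φ x) * η x) x⟫) - (G (φ x) * η x * dvg E x
        + ⟪gradient (fun x => G (φ x) * η x) x, E x⟫)) = 0 := by
      rw [integral_sub hs1 hs2, integral_add j1 j2, integral_add d1 d2, w1, d3]
      ring
    rw [← total]
    refine integral_mono (hKi n) (hs1.sub hs2) fun x => ?_
    have hpt := pointwise_coercivity (f := f₀ x) (D := dvg E x) (r := ‖x‖) (a := 1 + ‖x‖ ^ 2)
      (N := ‖gradient φ x‖) (y := ⟪gradient φ x, x⟫) (u := ⟪x, E x⟫) (τ := radCutSlope R x)
      hp hk hC₀ hlam (hG0 (φ x)) (hGle (φ x)) (hb2 (φ x)) (hb'0 (φ x)) (hbp (φ x)) rfl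
      (norm_nonneg _) (abs_real_inner_le_norm _ _) (hu x) (hE2 x) (radCut_nonneg R x) (hw0 x)
    refine hpt.trans (le_of_eq ?_)
    simp only [g4, q4, inner_add_left, inner_add_right, inner_smul_left, inner_smul_right,
      real_inner_self_eq_norm_sq, conj_trivial]
    rw [real_inner_comm x (E x), real_inner_comm (gradient φ x) (E x)]
    simp only [σ, η, RCLike.inner_apply, conj_trivial]
    ring
  refine ⟨i1, i2, ?_⟩
  have hfin : ∫ x, P x ≤ 0 := le_of_tendsto' hKlim hKle
  have hs : Integrable fun x => φ x * b (φ x) * jap k x / p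
      + b' (φ x) * ‖gradient φ x‖ ^ 2 * jap k x / 2 := (i1.div_const p).add (i2.div_const 2)
  simp only [hPe] at hfin
  rw [integral_sub hs (hfp.div_const p), integral_add (i1.div_const p) (i2.div_const 2), integral_div,
    integral_div, integral_div] at hfin
  linarith

/-- Under the growth hypothesis, the radial part of `E` grows at most quadratically. -/
lemma exists_abs_inner_le {d : ℕ} {E : EuclideanSpace ℝ (Fin d) → EuclideanSpace ℝ (Fin d)}
    (hE : H1 E) : ∃ C : ℝ, 0 ≤ C ∧ ∀ x, |⟪x, E x⟫| ≤ C * (1 + ‖x‖ ^ 2) := by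
  obtain ⟨α, α₂, β, β₂, γ, γ₂, hα, hα₂, hγ, hγγ₂, hγ₂, h⟩ := hE
  refine ⟨α₂ + |β| + |β₂|, by positivity, fun x => ?_⟩
  obtain ⟨h1, h2⟩ := h x
  have h3 : ‖x‖ ^ γ₂ ≤ 1 + ‖x‖ ^ 2 := by
    rcases le_total ‖x‖ 1 with hx | hx
    · have := rpow_le_one (norm_nonneg x) hx (by linarith : 0 ≤ γ₂)
      nlinarith [sq_nonneg ‖x‖]
    · have := rpow_le_rpow_of_exponent_le hx hγ₂
      rw [rpow_two] at this
      linarith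
  have h4 : 0 ≤ α * ‖x‖ ^ γ := by positivity
  have h5 := mul_le_mul_of_nonneg_left h3 hα₂.le
  have h6 : 0 ≤ ‖x‖ ^ 2 := sq_nonneg _
  have h7 := mul_nonneg (abs_nonneg β) h6
  have h8 := mul_nonneg (abs_nonneg β₂) h6
  have h9 := mul_nonneg hα₂.le h6
  rw [abs_le]
  constructor <;> nlinarith [le_abs_self β, le_abs_self β₂, neg_abs_le β, neg_abs_le β₂]

lemma integrable_of_integrable_mul_jap {d : ℕ} {k : ℝ} (hk : 0 < k)
    {f : EuclideanSpace ℝ (Fin d) → ℝ} (hfm : AEStronglyMeasurable f volume) (hf0 : ∀ x, 0 ≤ f x)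
    (hf : Integrable fun x => f x * jap k x) : Integrable f := by
  refine hf.mono' hfm (Eventually.of_forall fun x => ?_)
  rw [Real.norm_eq_abs, abs_of_nonneg (hf0 x)]
  exact le_mul_of_one_le_right (hf0 x) (one_le_jap hk x)

lemma jap_neg_mul_jap {d : ℕ} (k : ℝ) (x : EuclideanSpace ℝ (Fin d)) :
    jap (-k) x * jap k x = 1 := by
  have : 0 < 1 + ‖x‖ ^ 2 := by positivity
  unfold jap
  rw [← rpow_add this]
  simp [neg_div]

/-- A weak formulation tested with `ψ ⟨x⟩ᵏ` yields the unweighted one. -/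
lemma weak_form_unweighted {d : ℕ} {k lam : ℝ} {f₀ φ : EuclideanSpace ℝ (Fin d) → ℝ}
    {F : EuclideanSpace ℝ (Fin d) → EuclideanSpace ℝ (Fin d)}
    (hf : MemLp f₀ 2 volume) (hφ : MemLp φ 2 volume)
    (hw : ∀ ψ : EuclideanSpace ℝ (Fin d) → ℝ, ContDiff ℝ (⊤ : ℕ∞) ψ → HasCompactSupport ψ →
      lam * (∫ x, φ x * ψ x * jap k x) + (∫ x, ⟪F x, gradient (fun y => ψ y * jap k y) x⟫)
        = ∫ x, f₀ x * ψ x * jap k x)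
    {ψ : EuclideanSpace ℝ (Fin d) → ℝ} (hψ : ContDiff ℝ (⊤ : ℕ∞) ψ) (hψs : HasCompactSupport ψ) :
    (∫ x, ⟪lam * φ x - f₀ x, ψ x⟫) + ∫ x, ⟪F x, gradient ψ x⟫ = 0 := by
  have h := hw (fun x => ψ x * jap (-k) x) (hψ.mul (contDiff_jap (-k))) hψs.mul_right
  have e : ∀ x, ψ x * jap (-k) x * jap k x = ψ x := fun x => by
    rw [mul_assoc, jap_neg_mul_jap, mul_one]
  simp only [mul_assoc (φ _), mul_assoc (f₀ _), e] at h
  have hψ2 : MemLp ψ 2 volume := hψ.continuous.memLp_of_hasCompactSupport hψs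
  have h1 : Integrable fun x => φ x * ψ x := hφ.integrable_mul hψ2
  have h2 : Integrable fun x => f₀ x * ψ x := hf.integrable_mul hψ2
  have h3 : ∫ x, ⟪lam * φ x - f₀ x, ψ x⟫ = lam * (∫ x, φ x * ψ x) - ∫ x, f₀ x * ψ x := by
    rw [← integral_const_mul, ← integral_sub (h1.const_mul lam) h2]
    refine integral_congr_ae (Eventually.of_forall fun x => ?_)
    simp only [RCLike.inner_apply, conj_trivial]
    ring
  rw [h3]
  linarith

lemma memLp_indicator_closedBall_add_smul {d : ℕ} {φ : EuclideanSpace ℝ (Fin d) → ℝ}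
    {g E : EuclideanSpace ℝ (Fin d) → EuclideanSpace ℝ (Fin d)} (hg : MemLp g 2 volume)
    (hφ : Continuous φ) (hE : Continuous E) (R : ℝ) :
    MemLp ((Metric.closedBall 0 R).indicator fun x => g x + φ x • E x) 2 volume := by
  have hm : MeasurableSet (Metric.closedBall (0 : EuclideanSpace ℝ (Fin d)) R) :=
    Metric.isClosed_closedBall.measurableSet
  have hc : Continuous fun x => φ x • E x := hφ.smul hE
  rw [memLp_indicator_iff_restrict hm]
  refine (hg.restrict _).add ?_
  obtain ⟨C, hC⟩ := (isCompact_closedBall (0 : EuclideanSpace ℝ (Fin d)) R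
    ).exists_bound_of_continuousOn hc.continuousOn
  have : IsFiniteMeasure (volume.restrict (Metric.closedBall (0 : EuclideanSpace ℝ (Fin d)) R)) :=
    ⟨by simpa using measure_closedBall_lt_top⟩
  exact MemLp.of_bound hc.aestronglyMeasurable C
    ((ae_restrict_iff' hm).2 (Eventually.of_forall hC))

/-- under (H0), (H1) and (H2) for an exponent `p ∈ [2,∞)`
(with conjugate `p'`), there is `λ₁` such that for `λ ≥ λ₁` and `0 ≤ f₀ ∈ L²ₖ ∩ Lᵖₖ`,
the weak solution `φ ∈ H¹ₖ` of `λφ − div(∇φ + Eφ) = f₀` belongs to `Lᵖₖ` with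
`‖φ‖_{Lᵖₖ} ≤ ‖f₀‖_{Lᵖₖ}`, and `∫ |∇φ|² φ^{p−2} ⟨x⟩ᵏ < ∞`. -/
theorem stmt10 (d : ℕ) (hd : 1 ≤ d) (k : ℝ) (hk : 0 < k)
    (p p' : ℝ) (hp : 2 ≤ p) (hp' : 1 / p + 1 / p' = 1)
    (E : EuclideanSpace ℝ (Fin d) → EuclideanSpace ℝ (Fin d))
    (hE0 : H0 E) (hE1 : H1 E)
    (β₀ : ℝ)
    (hE2 : ∀ x : EuclideanSpace ℝ (Fin d),
      β₀ ≤ -(p / p') * dvg E x + k * ⟪x, E x⟫ / (1 + ‖x‖ ^ 2)) :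
    ∃ lam1 : ℝ, ∀ lam : ℝ, lam1 ≤ lam →
      ∀ f₀ : EuclideanSpace ℝ (Fin d) → ℝ,
        AEStronglyMeasurable f₀ volume →
        Integrable (fun x => f₀ x ^ 2 * jap k x) →
        Integrable (fun x => |f₀ x| ^ p * jap k x) →
        (∀ᵐ x, 0 ≤ f₀ x) →
        ∀ φ : EuclideanSpace ℝ (Fin d) → ℝ,
          Differentiable ℝ φ →
          Integrable (fun x => φ x ^ 2 * jap k x) →
          Integrable (fun x => ‖gradient φ x‖ ^ 2 * jap k x) →
          (∀ ψ : EuclideanSpace ℝ (Fin d) → ℝ,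
            ContDiff ℝ (⊤ : ℕ∞) ψ → HasCompactSupport ψ →
              lam * (∫ x, φ x * ψ x * jap k x)
                + (∫ x, ⟪gradient φ x + φ x • E x, gradient (fun y => ψ y * jap k y) x⟫)
                = ∫ x, f₀ x * ψ x * jap k x) →
          Integrable (fun x => |φ x| ^ p * jap k x) ∧
          (∫ x, |φ x| ^ p * jap k x) ≤ (∫ x, |f₀ x| ^ p * jap k x) ∧
          Integrable (fun x => ‖gradient φ x‖ ^ 2 * |φ x| ^ (p - 2) * jap k x) := by
  have hp0 : 0 < p := by linarith
  have hpp : p / p' = p - 1 := by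
    have : p' ≠ 0 := by
      rintro rfl
      simp only [div_zero, add_zero] at hp'
      rw [div_eq_iff hp0.ne'] at hp'
      linarith
    field_simp at hp' ⊢
    linarith
  rw [hpp] at hE2
  obtain ⟨C₀, hC₀, hu⟩ := exists_abs_inner_le hE1
  refine ⟨1 + |β₀| + k * C₀ + k ^ 2 / 2, ?_⟩
  intro lam hlam f₀ hfm hf2 hfp _ φ hφ hφ2 hφ'2 hw
  have hφc := hφ.continuous
  have hw0 : ∀ x : EuclideanSpace ℝ (Fin d), 0 ≤ jap k x :=
    fun x => zero_le_one.trans (one_le_jap hk x)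
  have hgm : AEStronglyMeasurable (gradient φ) volume :=
    (measurable_gradient φ).aestronglyMeasurable
  have mφ : MemLp φ 2 volume := (memLp_two_iff_integrable_sq hφc.aestronglyMeasurable).2
    (integrable_of_integrable_mul_jap hk (hφc.pow 2).aestronglyMeasurable
      (fun x => sq_nonneg _) hφ2)
  have mf : MemLp f₀ 2 volume := (memLp_two_iff_integrable_sq hfm).2
    (integrable_of_integrable_mul_jap hk (hfm.pow 2) (fun x => sq_nonneg _) hf2)
  have mg : MemLp (gradient φ) 2 volume := (memLp_two_iff_integrable_sq_norm hgm).2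
    (integrable_of_integrable_mul_jap hk (hgm.norm.pow 2) (fun x => sq_nonneg _) hφ'2)
  obtain ⟨m, hm⟩ : ∃ m : ℝ, m = (p - 2) / 2 := ⟨_, rfl⟩
  have hm0 : 0 ≤ m := by rw [hm]; linarith
  have hm2 : 2 * m = p - 2 := by rw [hm]; ring
  have hpow : ∀ s : ℝ, |s| * |s| ^ (2 * m) = |s| ^ (p - 1) := fun s => by
    rw [show p - 1 = 1 + 2 * m by rw [hm2]; ring,
      rpow_add_of_nonneg (abs_nonneg s) zero_le_one (by linarith), rpow_one]
  have hpow2 : ∀ s : ℝ, s * (s * |s| ^ (2 * m)) = |s| ^ p := fun s => by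
    rw [show p = 2 + 2 * m by rw [hm2]; ring,
      rpow_add_of_nonneg (abs_nonneg s) zero_le_two (by linarith), rpow_two, sq_abs]
    ring
  let e : ℕ → ℝ := fun n => 1 / ((n : ℝ) + 1)
  have he : ∀ n, 0 < e n := fun n => Nat.one_div_pos_of_nat
  have he0 : Tendsto e atTop (𝓝 0) := tendsto_one_div_add_atTop_nhds_zero_nat
  have hD0 : ∀ n s, 0 ≤ truncTestDeriv m (e n) s := fun n s =>
    le_trans (div_nonneg (truncPow_nonneg (he n) s) (by linarith))
      (truncPow_le_truncTestDeriv hm0 (he n) s)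
  have key := fun n => truncated_energy_estimate hk hp hC₀ hlam hE0 hu hE2 hfp
    ((mφ.const_mul lam).sub mf) hφ hφ2 hφ'2 mg
    (memLp_indicator_closedBall_add_smul mg hφc hE0.1.continuous)
    (fun ψ h1 h2 => weak_form_unweighted mf mφ hw h1 h2)
    (hasDerivAt_truncTest hm0 (he n)) (continuous_truncTestDeriv hm0 (he n))
    (hasDerivAt_truncPrim hm0 (he n)) (truncPrim_nonneg hm0 (he n)) (truncPrim_le hm0 (he n))
    (sq_truncTest_le hm0 (he n)) (hD0 n)
    (fun s => (abs_truncTest_le_mul hm0 (he n) s).trans ((mul_le_mul_of_nonneg_left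
      (truncPow_le_abs_rpow hm0 (he n) s) (abs_nonneg s)).trans_eq (hpow s)))
    (C := (1 + 2 * m) * ((e n)⁻¹) ^ m)
    (fun s => (truncTestDeriv_le hm0 (he n) s).trans
      (mul_le_mul_of_nonneg_left (truncPow_le hm0 (he n) s) (by linarith)))
    (fun s => by
      have h1 := abs_truncTest_le_mul hm0 (he n) s
      have h2 := mul_le_mul_of_nonneg_left (truncPow_le hm0 (he n) s) (abs_nonneg s)
      have h3 : 0 ≤ 2 * m * (((e n)⁻¹) ^ m * |s|) := by
        have := (he n).le
        positivity
      linarith)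
  have hT0 : ∀ n s, 0 ≤ s * truncTest m (e n) s := fun n s =>
    (truncPrim_nonneg hm0 (he n) s).trans (truncPrim_le hm0 (he n) s)
  have hφp := integrable_of_tendsto_of_integral_le (f := fun x => |φ x| ^ p * jap k x)
    (C := ∫ x, |f₀ x| ^ p * jap k x)
    (fun n => (key n).1) (fun n x => mul_nonneg (hT0 n _) (hw0 x))
    (fun x => by
      rw [← hpow2 (φ x)]
      exact ((tendsto_truncTest hm0 he0 (φ x)).const_mul (φ x)).mul_const (jap k x))
    (fun n => by
      have h1 : 0 ≤ ∫ x, truncTestDeriv m (e n) (φ x) * ‖gradient φ x‖ ^ 2 * jap k x :=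
        integral_nonneg fun x => mul_nonneg (mul_nonneg (hD0 n _) (sq_nonneg _)) (hw0 x)
      have h2 := (key n).2.2
      refine (div_le_div_iff_of_pos_right hp0).1 ?_
      linarith)
  refine ⟨hφp.1, hφp.2, ?_⟩
  have hle : ∀ n x, ‖gradient φ x‖ ^ 2 * truncPow m (e n) (φ x) * jap k x ≤
      (1 + m) * (truncTestDeriv m (e n) (φ x) * ‖gradient φ x‖ ^ 2 * jap k x) := fun n x => by
    have h1 := truncPow_le_truncTestDeriv hm0 (he n) (φ x)
    rw [div_le_iff₀ (by linarith)] at h1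
    have h2 := mul_le_mul_of_nonneg_right h1 (mul_nonneg (sq_nonneg ‖gradient φ x‖) (hw0 x))
    linarith
  have hpos : ∀ n x, 0 ≤ ‖gradient φ x‖ ^ 2 * truncPow m (e n) (φ x) * jap k x := fun n x =>
    mul_nonneg (mul_nonneg (sq_nonneg _) (truncPow_nonneg (he n) _)) (hw0 x)
  have hgi : ∀ n, Integrable fun x =>
      ‖gradient φ x‖ ^ 2 * truncPow m (e n) (φ x) * jap k x := fun n => by
    refine ((key n).2.1.const_mul (1 + m)).mono' ?_ (Eventually.of_forall fun x => ?_)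
    · exact ((hgm.norm.pow 2).mul
        ((continuous_truncPow hm0 (he n)).comp hφc).aestronglyMeasurable).mul
        (continuous_jap k).aestronglyMeasurable
    · rw [Real.norm_eq_abs, abs_of_nonneg (hpos n x)]
      exact hle n x
  refine (integrable_of_tendsto_of_integral_le
    (C := (1 + m) * (2 * ((∫ x, |f₀ x| ^ p * jap k x) / p))) hgi hpos (fun x => ?_)
    (fun n => ?_)).1
  · rw [← hm2]
    exact ((tendsto_truncPow hm0 he0 (φ x)).const_mul _).mul_const _
  · have h1 : 0 ≤ (∫ x, φ x * truncTest m (e n) (φ x) * jap k x) / p :=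
      div_nonneg (integral_nonneg fun x => mul_nonneg (hT0 n _) (hw0 x)) hp0.le
    have h2 := (key n).2.2
    refine (integral_mono (hgi n) ((key n).2.1.const_mul (1 + m)) (hle n)).trans ?_
    rw [integral_const_mul]
    refine mul_le_mul_of_nonneg_left ?_ (by linarith)
    linarith
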